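/- arXiv:math/0305116 — 3 statements merged into one kernel-verified Lean document; each statement's English description precedes it below -/
import Mathlib

section
/- Suppose m, n are natural numbers and x_1, …, x_m, y_1, …, y_n are positive real numbers such that P_Λ(t) · ∏_{j=1}^n (1 − y_j t) = ∏_{i=1}^m (1 + x_i t) as formal power series over ℝ. Then all coefficients of the polynomials ∏_{i=1}^m (1 + x_i t) and ∏_{j=1}^n (1 − y_j t) are integers; equivalently, every elementary symmetric function e_i(x_1, …, x_m) and e_j(y_1, …, y_n) is an integer. -/
open TensorProduct Polynomial

noncomputable section

/-- The linear map `V ⊗ V → T(V)` sending `v ⊗ w` to `ι v * ι w`. -/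
def mulTwo (K : Type) [Field K] (V : Type) [AddCommGroup V] [Module K V] :
    V ⊗[K] V →ₗ[K] TensorAlgebra K V :=
  TensorProduct.lift
    ((LinearMap.mul K (TensorAlgebra K V)).compl₁₂ (TensorAlgebra.ι K) (TensorAlgebra.ι K))

/-- `R : V ⊗ V → V ⊗ V` is a Hecke symmetry with parameter `q`:
it is invertible, satisfies the braid relation, the Hecke relation
`(R + 1)(R - q) = 0`, and its half adjoint `R♯ : V* ⊗ V → V ⊗ V*`,
characterized by `⟨R♯(ξ ⊗ v), w⟩ = ⟨ξ, R(v ⊗ w)⟩`, is invertible. -/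
def IsHeckeSymmetry (K : Type) [Field K] (V : Type) [AddCommGroup V] [Module K V]
    (q : K) (R : V ⊗[K] V →ₗ[K] V ⊗[K] V) : Prop :=
  Function.Bijective R ∧
  (TensorProduct.map R LinearMap.id ∘ₗ
      ((TensorProduct.assoc K V V V).symm.toLinearMap ∘ₗ
        TensorProduct.map LinearMap.id R ∘ₗ (TensorProduct.assoc K V V V).toLinearMap) ∘ₗ
      TensorProduct.map R LinearMap.id =
    ((TensorProduct.assoc K V V V).symm.toLinearMap ∘ₗ
        TensorProduct.map LinearMap.id R ∘ₗ (TensorProduct.assoc K V V V).toLinearMap) ∘ₗ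
      TensorProduct.map R LinearMap.id ∘ₗ
      ((TensorProduct.assoc K V V V).symm.toLinearMap ∘ₗ
        TensorProduct.map LinearMap.id R ∘ₗ (TensorProduct.assoc K V V V).toLinearMap)) ∧
  ((R + LinearMap.id) ∘ₗ (R - q • LinearMap.id) = 0) ∧
  (∃ Rs : Module.Dual K V ⊗[K] V →ₗ[K] V ⊗[K] Module.Dual K V,
    Function.Bijective Rs ∧
    ∀ (ξ : Module.Dual K V) (v w : V),
      dualTensorHom K V V ((TensorProduct.comm K V (Module.Dual K V)) (Rs (ξ ⊗ₜ[K] v))) w =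
        TensorProduct.lid K V (TensorProduct.map ξ LinearMap.id (R (v ⊗ₜ[K] w))))

/-- The relation on `T(V)` whose closure cuts out the exterior algebra `Λ` of `R`:
all elements of the image of `R + 1` in degree two are set to zero. -/
def lambdaRel (K : Type) [Field K] (V : Type) [AddCommGroup V] [Module K V]
    (R : V ⊗[K] V →ₗ[K] V ⊗[K] V) :
    TensorAlgebra K V → TensorAlgebra K V → Prop :=
  fun a b => b = 0 ∧ ∃ u : V ⊗[K] V, a = mulTwo K V ((R + (LinearMap.id : V ⊗[K] V →ₗ[K] V ⊗[K] V)) u)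

/-- The `l`-th homogeneous component of the exterior algebra `Λ = T(V)/(im(R+1))`,
as the image of the `l`-th graded piece of the tensor algebra. -/
def lambdaGrade (K : Type) [Field K] (V : Type) [AddCommGroup V] [Module K V]
    (R : V ⊗[K] V →ₗ[K] V ⊗[K] V) (l : ℕ) :
    Submodule K (RingQuot (lambdaRel K V R)) :=
  Submodule.map (RingQuot.mkAlgHom K (lambdaRel K V R)).toLinearMap
    (LinearMap.range (TensorAlgebra.ι K : V →ₗ[K] TensorAlgebra K V) ^ l)

/-- The Poincaré series `P_Λ(t) = ∑ (dim Λ_l) t^l` of the exterior algebra,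
as a formal power series over `ℝ`. -/
def poincareLambda (K : Type) [Field K] (V : Type) [AddCommGroup V] [Module K V]
    (R : V ⊗[K] V →ₗ[K] V ⊗[K] V) : PowerSeries ℝ :=
  PowerSeries.mk fun l => (Module.finrank K (lambdaGrade K V R l) : ℝ)

theorem aux_C_prime (p : ℤ) (hp : Prime p) : Prime (PowerSeries.C p : PowerSeries ℤ) := by
  have key : ∀ G : PowerSeries ℤ,
      PowerSeries.C p ∣ G ↔ PowerSeries.map (Ideal.Quotient.mk (Ideal.span {p})) G = 0 := by
    intro G
    constructor
    · rintro ⟨H, rfl⟩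
      have hp0 : Ideal.Quotient.mk (Ideal.span {p}) p = 0 :=
        Ideal.Quotient.eq_zero_iff_mem.2 (Ideal.mem_span_singleton_self p)
      rw [map_mul, PowerSeries.map_C, hp0, map_zero, zero_mul]
    · intro h
      have h1 : ∀ i, ∃ c, PowerSeries.coeff i G = p * c := by
        intro i
        have h2 := congrArg (PowerSeries.coeff i) h
        rw [PowerSeries.coeff_map, map_zero, Ideal.Quotient.eq_zero_iff_mem,
          Ideal.mem_span_singleton] at h2
        exact h2
      choose c hc using h1
      refine ⟨PowerSeries.mk c, ?_⟩
      ext i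
      rw [PowerSeries.coeff_C_mul, PowerSeries.coeff_mk, hc]
  have : (Ideal.span {p}).IsPrime := (Ideal.span_singleton_prime hp.ne_zero).2 hp
  refine ⟨?_, ?_, ?_⟩
  · intro h
    apply hp.ne_zero
    simpa using congrArg PowerSeries.constantCoeff h
  · intro h
    apply hp.not_unit
    simpa using h.map (PowerSeries.constantCoeff (R := ℤ))
  · intro a b
    rw [key, key, key, map_mul]
    exact mul_eq_zero.1

theorem aux_dvd (N : ℤ) : N ≠ 0 → ∀ Q G : PowerSeries ℤ, Q * G = PowerSeries.C N →
    PowerSeries.C (PowerSeries.constantCoeff Q) ∣ Q := by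
  induction N using UniqueFactorizationMonoid.induction_on_prime with
  | h₁ => intro h; exact absurd rfl h
  | h₂ x hx =>
    intro _ Q G h
    have hu : IsUnit (Q * G) := by rw [h]; exact hx.map _
    have hQ : IsUnit Q := isUnit_of_mul_isUnit_left hu
    exact ((hQ.map (PowerSeries.constantCoeff (R := ℤ))).map (PowerSeries.C (R := ℤ))).dvd
  | h₃ a p ha hp ih =>
    intro _ Q G h
    have hP := aux_C_prime p hp
    rw [map_mul] at h
    have hd : PowerSeries.C p ∣ Q * G := ⟨_, h⟩
    rcases hP.dvd_or_dvd hd with ⟨Q', rfl⟩ | ⟨G', rfl⟩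
    · rw [mul_assoc] at h
      have := ih ha Q' G (mul_left_cancel₀ hP.ne_zero h)
      rw [map_mul, map_mul]
      simpa using mul_dvd_mul_left (PowerSeries.C p) this
    · rw [mul_left_comm] at h
      exact ih ha Q G' (mul_left_cancel₀ hP.ne_zero h)

theorem aux_clear (q : ℚ[X]) : ∃ d : ℤ, d ≠ 0 ∧ ∃ Q : ℤ[X],
    Q.map (Int.castRingHom ℚ) = Polynomial.C (d : ℚ) * q := by
  obtain ⟨b, hb⟩ := IsLocalization.integerNormalization_map_to_map (nonZeroDivisors ℤ) q
  refine ⟨b, nonZeroDivisors.ne_zero b.2, IsLocalization.integerNormalization (nonZeroDivisors ℤ) q, ?_⟩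
  ext i
  have := congrArg (fun r => Polynomial.coeff r i) hb
  simpa using this

theorem aux_rat (F : PowerSeries ℤ) (p q : ℚ[X]) (hq : q.coeff 0 = 1) (hc : IsCoprime p q)
    (h : PowerSeries.map (Int.castRingHom ℚ) F * (q : PowerSeries ℚ) = (p : PowerSeries ℚ)) :
    ∃ Q : PowerSeries ℤ, PowerSeries.map (Int.castRingHom ℚ) Q = (q : PowerSeries ℚ) := by
  obtain ⟨u, v, huv⟩ := hc
  obtain ⟨d1, hd1, U, hU⟩ := aux_clear u
  obtain ⟨d2, hd2, W, hW⟩ := aux_clear v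
  obtain ⟨d3, hd3, Q, hQ⟩ := aux_clear q
  have inj : Function.Injective (PowerSeries.map (Int.castRingHom ℚ)) :=
    PowerSeries.map_injective _ (Int.cast_injective)
  have mapc : ∀ (A : ℤ[X]) (d : ℤ) (a : ℚ[X]), A.map (Int.castRingHom ℚ) = Polynomial.C (d : ℚ) * a →
      PowerSeries.map (Int.castRingHom ℚ) (A : PowerSeries ℤ) = PowerSeries.C (d : ℚ) * (a : PowerSeries ℚ) := by
    intro A d a hA
    rw [← Polynomial.polynomial_map_coe, hA, Polynomial.coe_mul, Polynomial.coe_C]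
  have hU' := mapc _ _ _ hU
  have hW' := mapc _ _ _ hW
  have hQ' := mapc _ _ _ hQ
  have huv' : (u : PowerSeries ℚ) * (p : PowerSeries ℚ) + (v : PowerSeries ℚ) * (q : PowerSeries ℚ) = 1 := by
    rw [← Polynomial.coe_mul, ← Polynomial.coe_mul, ← Polynomial.coe_add, huv, Polynomial.coe_one]
  have main : (Q : PowerSeries ℤ) * (PowerSeries.C d2 * U * F + PowerSeries.C d1 * W) =
      PowerSeries.C (d1 * d2 * d3) := by
    apply inj
    simp only [map_mul, map_add, hU', hW', hQ', PowerSeries.map_C, eq_intCast (Int.castRingHom ℚ)]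
    rw [← h] at huv'
    linear_combination PowerSeries.C (d1 : ℚ) * PowerSeries.C (d2 : ℚ) * PowerSeries.C (d3 : ℚ) * huv'
  have hQ0 : PowerSeries.constantCoeff (Q : PowerSeries ℤ) = d3 := by
    have h1 := congrArg (fun r => Polynomial.coeff r 0) hQ
    simp only [Polynomial.coeff_map, Polynomial.coeff_C_mul, hq, mul_one, eq_intCast] at h1
    rw [← PowerSeries.coeff_zero_eq_constantCoeff_apply, Polynomial.coeff_coe]
    exact_mod_cast h1
  obtain ⟨S, hS⟩ := aux_dvd _ (mul_ne_zero (mul_ne_zero hd1 hd2) hd3) _ _ main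
  rw [hQ0] at hS
  refine ⟨S, ?_⟩
  have h2 := congrArg (PowerSeries.map (Int.castRingHom ℚ)) hS
  rw [hQ', map_mul, PowerSeries.map_C] at h2
  have h3 : (PowerSeries.C (d3 : ℚ)) ≠ 0 := by
    intro h
    apply hd3
    simpa using congrArg PowerSeries.constantCoeff h
  exact (mul_left_cancel₀ h3 h2).symm

theorem aux_real (F : PowerSeries ℤ) (p q : ℝ[X]) (hq : q.coeff 0 = 1) (hc : IsCoprime p q)
    (h : PowerSeries.map (Int.castRingHom ℝ) F * (q : PowerSeries ℝ) = (p : PowerSeries ℝ)) :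
    ∃ Q : PowerSeries ℤ, PowerSeries.map (Int.castRingHom ℝ) Q = (q : PowerSeries ℝ) := by
  obtain ⟨φ, hφ⟩ := LinearMap.exists_leftInverse_of_injective (Algebra.linearMap ℚ ℝ)
    (LinearMap.ker_eq_bot.2 (algebraMap ℚ ℝ).injective)
  have hφ1 : φ 1 = 1 := by simpa using LinearMap.congr_fun hφ 1
  have hφz : ∀ (z : ℤ) (r : ℝ), φ (z * r) = z * φ r := by
    intro z r
    rw [← zsmul_eq_mul, map_zsmul, zsmul_eq_mul]
  let T : ℝ[X] → ℚ[X] := fun r =>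
    ∑ i ∈ Finset.range (r.natDegree + 1), Polynomial.monomial i (φ (r.coeff i))
  have hT : ∀ r i, (T r).coeff i = φ (r.coeff i) := by
    intro r i
    simp only [T, Polynomial.finset_sum_coeff, Polynomial.coeff_monomial]
    rw [Finset.sum_ite_eq']
    split_ifs with hi
    · rfl
    · rw [Polynomial.coeff_eq_zero_of_natDegree_lt, map_zero]
      simpa using hi
  have hQ : PowerSeries.map (Int.castRingHom ℚ) F * (T q : PowerSeries ℚ) = (T p : PowerSeries ℚ) := by
    ext i
    have h1 := congrArg (fun r => φ (PowerSeries.coeff i r)) h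
    simp only [PowerSeries.coeff_mul, map_sum, PowerSeries.coeff_map, Polynomial.coeff_coe,
      eq_intCast, hφz] at h1
    simp only [PowerSeries.coeff_mul, PowerSeries.coeff_map, Polynomial.coeff_coe,
      eq_intCast, hT, h1]
  let c := Rat.castHom ℝ
  have hR : PowerSeries.map (Int.castRingHom ℝ) F * ((T q).map c : ℝ[X]) = (((T p).map c : ℝ[X]) : PowerSeries ℝ) := by
    have h1 := congrArg (PowerSeries.map c) hQ
    rw [map_mul, ← Polynomial.polynomial_map_coe, ← Polynomial.polynomial_map_coe] at h1
    rw [← h1]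
    congr 1
  have hcross : p * (T q).map c = q * (T p).map c := by
    apply Polynomial.coe_injective
    rw [Polynomial.coe_mul, Polynomial.coe_mul, ← h, ← hR]
    ring
  have hdvd : q ∣ (T q).map c := hc.symm.dvd_of_dvd_mul_left ⟨_, hcross⟩
  have hTq0 : (T q).coeff 0 = 1 := by rw [hT, hq, hφ1]
  have hTq : (T q).map c = q := by
    obtain ⟨s, hs⟩ := hdvd
    have hne : (T q).map c ≠ 0 := by
      intro h0
      have := congrArg (fun r => Polynomial.coeff r 0) h0
      simp [hTq0] at this
    have hdeg : ((T q).map c).natDegree ≤ q.natDegree := by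
      rw [Polynomial.natDegree_le_iff_coeff_eq_zero]
      intro N hN
      rw [Polynomial.coeff_map, hT, Polynomial.coeff_eq_zero_of_natDegree_lt hN]
      simp
    have hs0 : s ≠ 0 := by rintro rfl; simp at hs; exact hne (by simpa using hs)
    have hq0 : q ≠ 0 := by rintro rfl; simp at hq
    rw [hs, Polynomial.natDegree_mul hq0 hs0] at hdeg
    have hsd : s.natDegree = 0 := by omega
    rw [Polynomial.eq_C_of_natDegree_eq_zero hsd] at hs
    have h0 := congrArg (fun r => Polynomial.coeff r 0) hs
    simp [hTq0, hq] at h0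
    rw [hs, ← h0]
    simp
  have hTp : (T p).map c = p := by
    apply Polynomial.coe_injective
    rw [← hR, hTq, h]
  have hcop : IsCoprime (T p) (T q) := by
    rw [← Polynomial.isCoprime_map c, hTp, hTq]
    exact hc
  obtain ⟨Q, hQ'⟩ := aux_rat F (T p) (T q) hTq0 hcop hQ
  refine ⟨Q, ?_⟩
  rw [← hTq, Polynomial.polynomial_map_coe, ← hQ']
  ext i
  simp

/-- If `P_Λ(t) · ∏ (1 - yⱼ t) = ∏ (1 + xᵢ t)` with `xᵢ, yⱼ > 0`, then all
coefficients of the two polynomials are integers. -/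
theorem poincare_series_lambda_coeff_integer
    (K : Type) [Field K] [CharZero K]
    (V : Type) [AddCommGroup V] [Module K V] [FiniteDimensional K V]
    (q : K) (hq0 : q ≠ 0) (hq : ∀ n : ℕ, 1 < n → q ^ n ≠ 1)
    (R : V ⊗[K] V →ₗ[K] V ⊗[K] V) (hR : IsHeckeSymmetry K V q R)
    (m n : ℕ) (x : Fin m → ℝ) (y : Fin n → ℝ)
    (hx : ∀ i, 0 < x i) (hy : ∀ j, 0 < y j)
    (heq : poincareLambda K V R *
        ((∏ j : Fin n, (1 - Polynomial.C (y j) * Polynomial.X) : Polynomial ℝ) :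
          PowerSeries ℝ) =
      ((∏ i : Fin m, (1 + Polynomial.C (x i) * Polynomial.X) : Polynomial ℝ) :
        PowerSeries ℝ)) :
    (∀ i : ℕ, ∃ z : ℤ,
        (∏ i : Fin m, (1 + Polynomial.C (x i) * Polynomial.X)).coeff i = (z : ℝ)) ∧
    (∀ j : ℕ, ∃ z : ℤ,
        (∏ j : Fin n, (1 - Polynomial.C (y j) * Polynomial.X)).coeff j = (z : ℝ)) := by
  set p : ℝ[X] := ∏ i : Fin m, (1 + Polynomial.C (x i) * Polynomial.X) with hp
  set r : ℝ[X] := ∏ j : Fin n, (1 - Polynomial.C (y j) * Polynomial.X) with hr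
  have hr0 : r.coeff 0 = 1 := by
    rw [hr, Polynomial.coeff_zero_prod]
    simp
  have hc : IsCoprime p r := by
    refine IsCoprime.prod_left fun i _ => IsCoprime.prod_right fun j _ => ?_
    have hne : x i + y j ≠ 0 := (add_pos (hx i) (hy j)).ne'
    refine ⟨Polynomial.C (y j / (x i + y j)), Polynomial.C (x i / (x i + y j)), ?_⟩
    have e1 : Polynomial.C (y j / (x i + y j)) + Polynomial.C (x i / (x i + y j)) = (1 : ℝ[X]) := by
      rw [← Polynomial.C_add, ← Polynomial.C_1]
      congr 1
      field_simp
      ring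
    have e2 : Polynomial.C (y j / (x i + y j)) * Polynomial.C (x i) =
        Polynomial.C (x i / (x i + y j)) * Polynomial.C (y j) := by
      rw [← Polynomial.C_mul, ← Polynomial.C_mul]
      congr 1
      field_simp
    linear_combination e1 + Polynomial.X * e2
  let F : PowerSeries ℤ := PowerSeries.mk fun l => (Module.finrank K (lambdaGrade K V R l) : ℤ)
  have hF : PowerSeries.map (Int.castRingHom ℝ) F = poincareLambda K V R := by
    ext i
    simp [F, poincareLambda]
  rw [← hF] at heq
  obtain ⟨Q, hQ⟩ := aux_real F p r hr0 hc heq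
  constructor
  · intro i
    refine ⟨PowerSeries.coeff i (F * Q), ?_⟩
    rw [← Polynomial.coeff_coe, ← heq, ← hQ, ← map_mul, PowerSeries.coeff_map]
    rfl
  · intro j
    refine ⟨PowerSeries.coeff j Q, ?_⟩
    rw [← Polynomial.coeff_coe, ← hQ, PowerSeries.coeff_map]
    rfl

end
end

section
/- Suppose m, n are natural numbers and x_1, …, x_m, y_1, …, y_n are positive real numbers such that P_Λ(t) · ∏_{j=1}^n (1 − y_j t) = ∏_{i=1}^m (1 + x_i t) as formal power series over ℝ, and write ∏_{i=1}^m (1 + x_i t) = ∑_{i=0}^m a_i t^i, with the convention a_j = 0 for j < 0. Then for every natural number k, a_m · dim_k Λ_k = ∑_{i=0}^{k} a_{m−k+i} · h_i(y_1^{−1}, …, y_n^{−1}), where h_i denotes the complete homogeneous symmetric polynomial of degree i in n variables (h_0 = 1). -/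
open TensorProduct Polynomial

noncomputable section

/-- The complete homogeneous symmetric polynomial of degree `i` in `n` variables,
evaluated at `z : Fin n → ℝ`: the sum of all monomials of total degree `i`. -/
def completeHomog (n i : ℕ) (z : Fin n → ℝ) : ℝ :=
  ∑ c ∈ Finset.Nat.antidiagonalTuple n i, ∏ j : Fin n, z j ^ c j

theorem aux_completeHomog_series (n : ℕ) (z : Fin n → ℝ) :
    (PowerSeries.mk fun i => completeHomog n i z) *
      ((∏ j : Fin n, (1 - Polynomial.C (z j) * Polynomial.X) : Polynomial ℝ) : PowerSeries ℝ)
      = 1 := by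
  have h1 : (PowerSeries.mk fun i => completeHomog n i z) =
      ∏ j : Fin n, PowerSeries.mk (fun k => z j ^ k) := by
    ext d
    rw [PowerSeries.coeff_prod, PowerSeries.coeff_mk, completeHomog]
    symm
    refine Finset.sum_bij (fun l _ => (l : Fin n → ℕ)) ?_ ?_ ?_ ?_
    · intro l hl
      rw [Finset.Nat.mem_antidiagonalTuple]
      simpa using hl
    · intro a _ b _ h
      exact DFunLike.coe_injective h
    · intro b hb
      refine ⟨Finsupp.equivFunOnFinite.symm b, ?_, rfl⟩
      rw [Finset.Nat.mem_antidiagonalTuple] at hb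
      simpa using hb
    · intro l _
      simp
  rw [h1, ← Polynomial.coeToPowerSeries.ringHom_apply, map_prod, ← Finset.prod_mul_distrib]
  refine Finset.prod_eq_one fun j _ => ?_
  rw [Polynomial.coeToPowerSeries.ringHom_apply]
  ext d
  simp only [Polynomial.coe_sub, Polynomial.coe_mul, Polynomial.coe_one, Polynomial.coe_C, Polynomial.coe_X]
  rw [mul_sub, mul_one, map_sub, ← mul_assoc]
  rcases d with _ | d
  · simp
  · rw [PowerSeries.coeff_succ_mul_X, PowerSeries.coeff_mul_C]
    simp [pow_succ, PowerSeries.coeff_one]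

theorem aux_reflect {L : Type*} [CommRing L] (k : ℕ) : ∀ (z : Fin k → L),
    Polynomial.reflect k (∏ i : Fin k, (1 + Polynomial.C (z i) * Polynomial.X)) =
      ∏ i : Fin k, (Polynomial.X + Polynomial.C (z i)) ∧
    (∏ i : Fin k, (1 + Polynomial.C (z i) * Polynomial.X)).natDegree ≤ k := by
  induction k with
  | zero => intro z; simp
  | succ k ih =>
    intro z
    rw [Fin.prod_univ_castSucc, Fin.prod_univ_castSucc]
    have hd : (1 + Polynomial.C (z (Fin.last k)) * Polynomial.X).natDegree ≤ 1 := by compute_degree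
    obtain ⟨h1, h2⟩ := ih (fun i => z i.castSucc)
    refine ⟨?_, (Polynomial.natDegree_mul_le).trans (add_le_add h2 hd)⟩
    rw [Polynomial.reflect_mul _ _ h2 hd, h1, Polynomial.reflect_add, Polynomial.reflect_C_mul]
    congr 2
    · simp
    · rw [← pow_one Polynomial.X, Polynomial.reflect_monomial]; simp

theorem aux_final {m n : ℕ} (x : Fin m → ℝ) (y : Fin n → ℝ)
    (hx : ∀ i, 0 < x i)
    (P : Polynomial ℝ)
    (hP : P = ∏ i : Fin m, (1 + Polynomial.C (x i) * Polynomial.X))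
    (a : ℤ → ℝ) (ha : ∀ j : ℤ, a j = if 0 ≤ j then P.coeff j.toNat else 0)
    (F : PowerSeries ℝ)
    (hF : F * ((∏ j : Fin n, (1 - Polynomial.C (y j)⁻¹ * Polynomial.X) : Polynomial ℝ) :
          PowerSeries ℝ) = ((∏ i : Fin m, (1 + Polynomial.C (x i)⁻¹ * Polynomial.X) : Polynomial ℝ) :
          PowerSeries ℝ)) (l : ℕ) :
      P.coeff m * PowerSeries.coeff l F =
        ∑ i ∈ Finset.range (l + 1),
          a ((m : ℤ) - (l : ℤ) + (i : ℤ)) * completeHomog n i (fun j => (y j)⁻¹) := by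
  obtain ⟨hr, hd⟩ := aux_reflect m x
  rw [← hP] at hr hd
  have hcm : P.coeff m = ∏ i, x i := by
    have := congrArg (fun p => Polynomial.coeff p 0) hr
    simp only [Polynomial.coeff_reflect, Polynomial.revAt_zero] at this
    rw [this, Polynomial.coeff_zero_eq_eval_zero, Polynomial.eval_prod]
    simp
  have hG : Polynomial.C (P.coeff m) * (∏ i : Fin m, (1 + Polynomial.C (x i)⁻¹ * Polynomial.X)) = Polynomial.reflect m P := by
    rw [hr, hcm, map_prod, ← Finset.prod_mul_distrib]
    refine Finset.prod_congr rfl fun i _ => ?_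
    rw [mul_add, ← mul_assoc, ← map_mul, mul_inv_cancel₀ (hx i).ne']
    simp [add_comm]
  have h3 : PowerSeries.C (P.coeff m) * F = (PowerSeries.mk fun i => completeHomog n i (fun j => (y j)⁻¹)) * (Polynomial.reflect m P : Polynomial ℝ) := by
    have h4 := aux_completeHomog_series n (fun j => (y j)⁻¹)
    rw [← hG, Polynomial.coe_mul, Polynomial.coe_C, ← hF]
    linear_combination (-PowerSeries.C (P.coeff m) * F) * h4
  have h5 := congrArg (PowerSeries.coeff l) h3
  rw [PowerSeries.coeff_C_mul] at h5
  rw [h5, PowerSeries.coeff_mul, Finset.Nat.sum_antidiagonal_eq_sum_range_succ_mk]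
  refine Finset.sum_congr rfl fun i hi => ?_
  have hi : i ≤ l := by simpa [Nat.lt_succ_iff] using hi
  rw [PowerSeries.coeff_mk, Polynomial.coeff_coe, Polynomial.coeff_reflect, mul_comm, ha]
  congr 1
  by_cases h : l - i ≤ m
  · rw [Polynomial.revAt_le h, if_pos (by omega)]
    congr 1
    omega
  · rw [Polynomial.revAt_eq_self_of_lt (by omega), if_neg (by omega)]
    exact Polynomial.coeff_eq_zero_of_natDegree_lt (by omega)

theorem aux_bilateral {L : Type*} [Field L] (γ : ℤ → L) (d : ℕ) (c : ℕ → L) (hc : c 0 ≠ 0)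
    (hrec : ∀ k : ℤ, ∑ r ∈ Finset.range (d + 1), c r * γ (k + r) = 0)
    (D : ℕ) (P1 P2 : Polynomial L) (h1 : P1.natDegree ≤ D) (h2 : P2.natDegree ≤ D)
    (hG : (PowerSeries.mk fun k => if k = 0 then 1 else γ k) * (P1 : PowerSeries L) = P2) :
    (PowerSeries.mk fun j => (if j = 0 then 1 else 0) - γ (-(j : ℤ))) *
      ((Polynomial.reflect D P1 : Polynomial L) : PowerSeries L) =
      (Polynomial.reflect D P2 : Polynomial L) := by
  set ψ : ℤ → L := fun k => ∑ i ∈ Finset.range (D + 1), P1.coeff i * γ (k - i) with hψ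
  have hcoef : ∀ k : ℕ, P2.coeff k =
      ∑ i ∈ Finset.range (k + 1), P1.coeff i * (if k - i = 0 then 1 else γ ((k - i : ℕ) : ℤ)) := by
    intro k
    have := congrArg (PowerSeries.coeff k) hG
    rw [Polynomial.coeff_coe, mul_comm, PowerSeries.coeff_mul,
      Finset.Nat.sum_antidiagonal_eq_sum_range_succ_mk] at this
    rw [← this]
    refine Finset.sum_congr rfl fun i _ => ?_
    rw [PowerSeries.coeff_mk, Polynomial.coeff_coe]
  have hbig : ∀ k : ℕ, D < k → ψ k = 0 := by
    intro k hk
    have h := hcoef k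
    rw [Polynomial.coeff_eq_zero_of_natDegree_lt (by omega)] at h
    rw [h, hψ]
    rw [← Finset.sum_subset (Finset.range_mono (show D + 1 ≤ k + 1 by omega))]
    · refine Finset.sum_congr rfl fun i hi => ?_
      have := Finset.mem_range.1 hi
      rw [if_neg (by omega)]
      congr 2
      omega
    · intro i _ hi
      rw [Polynomial.coeff_eq_zero_of_natDegree_lt (by simp at hi; omega), zero_mul]
  have hψrec : ∀ k : ℤ, ∑ r ∈ Finset.range (d + 1), c r * ψ (k + r) = 0 := by
    intro k
    simp only [hψ, Finset.mul_sum]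
    rw [Finset.sum_comm]
    refine Finset.sum_eq_zero fun i _ => ?_
    have := hrec (k - i)
    calc _ = P1.coeff i * ∑ r ∈ Finset.range (d + 1), c r * γ (k - i + r) := by
          rw [Finset.mul_sum]
          refine Finset.sum_congr rfl fun r _ => ?_
          rw [show k + (r : ℤ) - i = k - i + r by ring]; ring
      _ = 0 := by rw [this, mul_zero]
  have hψ0 : ∀ t : ℕ, ∀ k : ℤ, (D : ℤ) + 1 - t ≤ k → ψ k = 0 := by
    intro t
    induction t with
    | zero =>
      intro k hk
      have := hbig k.toNat (by omega)
      rwa [Int.toNat_of_nonneg (by omega)] at this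
    | succ t ih =>
      intro k hk
      have h := hψrec k
      rw [Finset.sum_range_succ', Finset.sum_eq_zero, zero_add] at h
      · simpa [hc] using h
      · intro r _
        rw [ih _ (by push_cast at hk ⊢; omega), mul_zero]
  have hψz : ∀ k : ℤ, ψ k = 0 := fun k => hψ0 (D + 1 - k).toNat k (by omega)
  ext j
  rw [PowerSeries.coeff_mul, Finset.Nat.sum_antidiagonal_eq_sum_range_succ_mk]
  simp only [PowerSeries.coeff_mk, Polynomial.coeff_coe, Polynomial.coeff_reflect, sub_mul,
    Finset.sum_sub_distrib]
  rw [Finset.sum_range_succ' (fun i => (if i = 0 then (1 : L) else 0) * _)]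
  rw [Finset.sum_eq_zero (by intro i _; simp)]
  simp only [if_true, one_mul, zero_add, Nat.sub_zero]
  by_cases hj : j ≤ D
  · rw [Polynomial.revAt_le hj]
    have e1 := hcoef (D - j)
    rw [Finset.sum_range_succ, Nat.sub_self, if_pos rfl, mul_one] at e1
    have e2 := hψz ((D - j : ℕ) : ℤ)
    simp only [hψ] at e2
    rw [show D + 1 = (D - j) + (j + 1) by omega, Finset.sum_range_add] at e2
    have e3 : ∑ i ∈ Finset.range (j + 1), γ (-(i : ℤ)) * P1.coeff (Polynomial.revAt D (j - i)) =
        ∑ i ∈ Finset.range (j + 1), P1.coeff (D - j + i) * γ (((D - j : ℕ) : ℤ) - ((D - j + i : ℕ) : ℤ)) := by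
      refine Finset.sum_congr rfl fun i hi => ?_
      have := Finset.mem_range.1 hi
      rw [Polynomial.revAt_le (by omega), mul_comm]
      congr 2
      · omega
      · push_cast; ring
    have e4 : ∑ i ∈ Finset.range (D - j), P1.coeff i * (if D - j - i = 0 then 1 else γ ((D - j - i : ℕ) : ℤ)) =
        ∑ i ∈ Finset.range (D - j), P1.coeff i * γ (((D - j : ℕ) : ℤ) - i) := by
      refine Finset.sum_congr rfl fun i hi => ?_
      have := Finset.mem_range.1 hi
      rw [if_neg (by omega)]
      congr 2
      omega
    rw [e3, e1, e4]
    linear_combination -e2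
  · have hz : ∀ t, D < t → P1.coeff (Polynomial.revAt D t) = 0 := by
      intro t ht
      rw [Polynomial.revAt_eq_self_of_lt ht]
      exact Polynomial.coeff_eq_zero_of_natDegree_lt (by omega)
    rw [hz j (by omega), Polynomial.revAt_eq_self_of_lt (by omega),
      Polynomial.coeff_eq_zero_of_natDegree_lt (show P2.natDegree < j by omega), zero_sub, neg_eq_zero]
    have e2 := hψz ((D : ℤ) - j)
    simp only [hψ] at e2
    rw [show j.succ = (j - D) + (D + 1) by omega, Finset.sum_range_add, ← e2, Finset.sum_eq_zero, zero_add]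
    · refine Finset.sum_congr rfl fun i hi => ?_
      have := Finset.mem_range.1 hi
      rw [Polynomial.revAt_le (by omega), mul_comm]
      congr 2
      · omega
      · push_cast [Nat.cast_sub (show D ≤ j by omega)]; ring
    · intro i hi
      have := Finset.mem_range.1 hi
      rw [hz _ (by omega), mul_zero]

/-- product of linear factors, as a power series -/
def auxE {L : Type*} [Field L] {k : ℕ} (z : Fin k → L) : PowerSeries L :=
  ∏ i : Fin k, (1 + PowerSeries.C (z i) * PowerSeries.X)

theorem auxE_rescale {L : Type*} [Field L] {k : ℕ} (z : Fin k → L) (c : L) :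
    PowerSeries.rescale c (auxE z) = auxE (fun i => c * z i) := by
  unfold auxE
  rw [map_prod]
  refine Finset.prod_congr rfl fun i _ => ?_
  have hC : PowerSeries.rescale c (PowerSeries.C (z i)) = PowerSeries.C (z i) := by
    ext j
    simp only [PowerSeries.coeff_rescale, PowerSeries.coeff_C]
    split_ifs with h <;> simp [h]
  rw [map_add, map_one, map_mul, PowerSeries.rescale_X, hC, map_mul]
  ring

theorem auxE_const {L : Type*} [Field L] {k : ℕ} (z : Fin k → L) :
    PowerSeries.constantCoeff (auxE z) = 1 := by
  unfold auxE
  rw [map_prod]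
  simp

theorem auxE_coe {L : Type*} [Field L] {k : ℕ} (z : Fin k → L) :
    ((∏ i : Fin k, (1 + Polynomial.C (z i) * Polynomial.X) : Polynomial L) : PowerSeries L) =
      auxE z := by
  unfold auxE
  rw [← Polynomial.coeToPowerSeries.ringHom_apply, map_prod]
  simp

theorem auxE_coe' {L : Type*} [Field L] {k : ℕ} (z : Fin k → L) (hz : ∀ i, z i ≠ 0) :
    ((∏ i : Fin k, (Polynomial.X + Polynomial.C (z i)) : Polynomial L) : PowerSeries L) =
      PowerSeries.C (∏ i, z i) * auxE (fun i => (z i)⁻¹) := by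
  unfold auxE
  rw [← Polynomial.coeToPowerSeries.ringHom_apply, map_prod, map_prod, ← Finset.prod_mul_distrib]
  refine Finset.prod_congr rfl fun i _ => ?_
  rw [mul_add, ← mul_assoc, ← map_mul, mul_inv_cancel₀ (hz i)]
  simp [add_comm]

theorem aux_series {L : Type*} [Field L] (q : L) (hq0 : q ≠ 0) (hq : ∀ k : ℕ, q ^ (k + 1) ≠ 1)
    (p : ℤ → L) (d : ℕ) (c : ℕ → L) (hc : c 0 ≠ 0)
    (hrec : ∀ k : ℤ, ∑ r ∈ Finset.range (d + 1), c r * p (k + r) = 0)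
    (hN : ∀ k : ℕ, p (-1 - ((k + 1 : ℕ) : ℤ)) = q⁻¹ ^ (k + 1) * p k -
      (q - 1) * ∑ t ∈ Finset.HasAntidiagonal.antidiagonal k, p (-1 - (t.1 : ℤ)) * (q⁻¹ ^ (t.2 + 1) * p t.2))
    (lam : ℕ → L) (h0 : lam 0 = 1)
    (hNewton : ∀ k : ℕ, (1 - q⁻¹ ^ (k + 1)) * lam (k + 1) =
      (1 - q⁻¹) * ∑ t ∈ Finset.HasAntidiagonal.antidiagonal k, (-q⁻¹) ^ t.1 * p t.1 * lam t.2)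
    {m n : ℕ} (x : Fin m → L) (y : Fin n → L) (hx : ∀ i, x i ≠ 0) (hy : ∀ i, y i ≠ 0)
    (heq : PowerSeries.mk lam * auxE (fun i => - y i) = auxE x) :
    PowerSeries.mk lam * auxE (fun i => - (y i)⁻¹) = auxE (fun i => (x i)⁻¹) := by
  set Fm : PowerSeries L := PowerSeries.rescale (-1) (PowerSeries.mk lam) with hFm
  set γ : ℤ → L := fun k => (q - 1) * q ^ (-k) * p (k - 1) with hγ
  set Gq : PowerSeries L := PowerSeries.mk fun k => if k = 0 then 1 else γ k with hGq
  set Gi : PowerSeries L := PowerSeries.mk fun k => (if k = 0 then 1 else 0) - (q - 1) * p (-1 - (k : ℤ)) with hGi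
  have hγs : ∀ k : ℕ, γ ((k + 1 : ℕ) : ℤ) = (q - 1) * (q⁻¹ ^ (k + 1) * p k) := by
    intro k
    simp only [hγ]
    rw [zpow_neg, zpow_natCast, inv_pow, mul_assoc]
    congr 3
    push_cast; ring
  have hFmB : Fm * auxE y = auxE (fun i => - x i) := by
    have := congrArg (PowerSeries.rescale (-1 : L)) heq
    rw [map_mul, auxE_rescale, auxE_rescale] at this
    simpa using this
  -- Newton
  have hG1 : PowerSeries.rescale q⁻¹ Fm = Fm * Gq := by
    ext k
    rcases k with _ | k
    · simp [hFm, hGq]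
      rw [← PowerSeries.coeff_zero_eq_constantCoeff_apply, PowerSeries.coeff_rescale]
      simp
    · rw [PowerSeries.coeff_mul, Finset.Nat.antidiagonal_succ', Finset.sum_cons]
      simp only [Finset.sum_map, hGq, PowerSeries.coeff_mk, Function.Embedding.prodMap]
      simp only [Function.Embedding.coeFn_mk, Prod.map, Function.Embedding.refl_apply, if_true, mul_one]
      simp only [Nat.succ_eq_add_one, Nat.add_eq_zero_iff, one_ne_zero, and_false, if_false, hγs, hFm,
        PowerSeries.coeff_rescale, PowerSeries.coeff_mk]
      have h := hNewton k
      have h' : ∑ t ∈ Finset.HasAntidiagonal.antidiagonal k, (-1 : L) ^ t.1 * lam t.1 * ((q - 1) * (q⁻¹ ^ (t.2 + 1) * p t.2)) =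
          (-1) ^ k * ((1 - q⁻¹) * ∑ t ∈ Finset.HasAntidiagonal.antidiagonal k, (-q⁻¹) ^ t.1 * p t.1 * lam t.2) := by
        rw [← Finset.Nat.sum_antidiagonal_swap, Finset.mul_sum, Finset.mul_sum]
        refine Finset.sum_congr rfl fun t ht => ?_
        rw [← Finset.HasAntidiagonal.mem_antidiagonal.1 ht]
        simp only [Prod.fst_swap, Prod.snd_swap]
        have e : (-q⁻¹) ^ t.1 = (-1) ^ t.1 * q⁻¹ ^ t.1 := by rw [← mul_pow]; simp
        have e2 : ((-1 : L) ^ t.1) * (-1) ^ t.1 = 1 := by rw [← mul_pow]; simp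
        rw [e, pow_add, pow_succ]
        have e3 : (q - 1) * q⁻¹ = 1 - q⁻¹ := by field_simp
        linear_combination (-1) ^ t.2 * lam t.2 * p t.1 * q⁻¹ ^ t.1 * e3 - (-1) ^ t.2 * lam t.2 * p t.1 * q⁻¹ ^ t.1 * (1 - q⁻¹) * e2
      rw [h', ← h, pow_succ (-1 : L)]
      ring
  -- N
  have hκ : Gi * Gq = PowerSeries.C (1 - (q - 1) * p (-1)) := by
    ext k
    rcases k with _ | k
    · simp [hGi, hGq]
    · rw [PowerSeries.coeff_mul, Finset.Nat.antidiagonal_succ', Finset.sum_cons]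
      simp only [Finset.sum_map, hGq, hGi, PowerSeries.coeff_mk, Function.Embedding.prodMap]
      simp only [Function.Embedding.coeFn_mk, Prod.map, Function.Embedding.refl_apply, if_true, mul_one]
      simp only [Nat.succ_eq_add_one, Nat.add_eq_zero_iff, one_ne_zero, and_false, if_false, hγs,
        PowerSeries.coeff_C]
      rw [Finset.sum_congr rfl (fun (t : ℕ × ℕ) _ => sub_mul (if t.1 = 0 then (1 : L) else 0)
        ((q - 1) * p (-1 - (t.1 : ℤ))) ((q - 1) * (q⁻¹ ^ (t.2 + 1) * p t.2))), Finset.sum_sub_distrib]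
      have e1 : ∑ t ∈ Finset.HasAntidiagonal.antidiagonal k, (if t.1 = 0 then (1 : L) else 0) * ((q - 1) * (q⁻¹ ^ (t.2 + 1) * p t.2)) =
          (q - 1) * (q⁻¹ ^ (k + 1) * p k) := by
        rw [Finset.sum_eq_single (0, k)]
        · simp
        · intro t ht h
          rw [if_neg, zero_mul]
          rintro h'
          apply h
          have := Finset.HasAntidiagonal.mem_antidiagonal.1 ht
          ext <;> simp <;> omega
        · simp
      have e2 := hN k
      have e3 : ∑ t ∈ Finset.HasAntidiagonal.antidiagonal k, (q - 1) * p (-1 - (t.1 : ℤ)) * ((q - 1) * (q⁻¹ ^ (t.2 + 1) * p t.2)) =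
         (q - 1) * ((q - 1) * ∑ t ∈ Finset.HasAntidiagonal.antidiagonal k, p (-1 - (t.1 : ℤ)) * (q⁻¹ ^ (t.2 + 1) * p t.2)) := by
        rw [Finset.mul_sum, Finset.mul_sum]
        refine Finset.sum_congr rfl fun t ht => ?_
        ring
      rw [e1, e3, e2]
      ring
  -- P1, P2
  set P1 : Polynomial L := (∏ i, (1 + Polynomial.C (- x i) * Polynomial.X)) * ∏ i, (1 + Polynomial.C (q⁻¹ * y i) * Polynomial.X) with hP1
  set P2 : Polynomial L := (∏ i, (1 + Polynomial.C (q⁻¹ * - x i) * Polynomial.X)) * ∏ i, (1 + Polynomial.C (y i) * Polynomial.X) with hP2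
  have hGP : Gq * (P1 : PowerSeries L) = P2 := by
    rw [hP1, hP2, Polynomial.coe_mul, Polynomial.coe_mul, auxE_coe (fun i => - x i), auxE_coe y,
      auxE_coe (fun i => q⁻¹ * - x i), auxE_coe (fun i => q⁻¹ * y i), ← hFmB]
    have := congrArg (PowerSeries.rescale q⁻¹) hFmB
    rw [map_mul, auxE_rescale, auxE_rescale, hG1] at this
    linear_combination auxE y * this
  obtain ⟨r1, d1⟩ := aux_reflect m (fun i => - x i)
  obtain ⟨r2, d2⟩ := aux_reflect n (fun i => q⁻¹ * y i)
  obtain ⟨r3, d3⟩ := aux_reflect m (fun i => q⁻¹ * - x i)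
  obtain ⟨r4, d4⟩ := aux_reflect n y
  have hrec' : ∀ k : ℤ, ∑ r ∈ Finset.range (d + 1), (c r * q ^ r) * γ (k + r) = 0 := by
    intro k
    have := hrec (k - 1)
    calc _ = (q - 1) * q ^ (-k) * ∑ r ∈ Finset.range (d + 1), c r * p (k - 1 + r) := by
          rw [Finset.mul_sum]
          refine Finset.sum_congr rfl fun r _ => ?_
          simp only [hγ]
          rw [show k + (r : ℤ) - 1 = k - 1 + r by ring, neg_add, zpow_add₀ hq0, zpow_neg q r, zpow_natCast]
          field_simp
      _ = 0 := by rw [this, mul_zero]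
  have hB := aux_bilateral γ d (fun r => c r * q ^ r) (by simpa using hc) hrec' (m + n) P1 P2
    (Polynomial.natDegree_mul_le.trans (add_le_add d1 d2))
    (Polynomial.natDegree_mul_le.trans (add_le_add d3 d4)) hGP
  have hGi' : (PowerSeries.mk fun j => (if j = 0 then 1 else 0) - γ (-(j : ℤ))) = PowerSeries.rescale q Gi := by
    ext j
    simp only [hGi, PowerSeries.coeff_rescale, PowerSeries.coeff_mk, hγ, neg_neg, zpow_natCast]
    rw [mul_sub, show -(j : ℤ) - 1 = -1 - j by ring]
    congr 1
    · split_ifs with h <;> simp [h]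
    · ring
  rw [hGi', hP1, hP2, Polynomial.reflect_mul _ _ d1 d2, Polynomial.reflect_mul _ _ d3 d4, r1, r2, r3, r4,
    Polynomial.coe_mul, Polynomial.coe_mul, auxE_coe' _ (fun i => neg_ne_zero.2 (hx i)), auxE_coe' y hy,
    auxE_coe' _ (fun i => mul_ne_zero (inv_ne_zero hq0) (hy i)),
    auxE_coe' _ (fun i => mul_ne_zero (inv_ne_zero hq0) (neg_ne_zero.2 (hx i)))] at hB
  set a := auxE (fun i => (- x i)⁻¹) with ha
  set b := auxE (fun i => (y i)⁻¹) with hb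
  have hqa : auxE (fun i => (q⁻¹ * - x i)⁻¹) = PowerSeries.rescale q a := by
    rw [ha, auxE_rescale]; simp [mul_comm]
  have hqb : auxE (fun i => (q⁻¹ * y i)⁻¹) = PowerSeries.rescale q b := by
    rw [hb, auxE_rescale]; simp [mul_comm]
  rw [hqa, hqb] at hB
  have hqF : PowerSeries.rescale q Fm * PowerSeries.rescale q Gq = Fm := by
    rw [← map_mul, ← hG1, PowerSeries.rescale_rescale]
    simp [hq0]
  have hFG : Fm * PowerSeries.rescale q Gi = PowerSeries.C (1 - (q - 1) * p (-1)) * PowerSeries.rescale q Fm := by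
    have h := congrArg (PowerSeries.rescale q) hκ
    rw [map_mul] at h
    have hC : ∀ t : L, PowerSeries.rescale q (PowerSeries.C t) = PowerSeries.C t := by
      intro t
      ext j
      simp only [PowerSeries.coeff_rescale, PowerSeries.coeff_C]
      split_ifs with h <;> simp [h]
    rw [hC] at h
    linear_combination PowerSeries.rescale q Fm * h - PowerSeries.rescale q Gi * hqF
  have ca : PowerSeries.constantCoeff a = 1 := auxE_const _
  have cb : PowerSeries.constantCoeff b = 1 := auxE_const _
  have cF : PowerSeries.constantCoeff Fm = 1 := by
    rw [← PowerSeries.coeff_zero_eq_constantCoeff_apply, hFm, PowerSeries.coeff_rescale]; simp [h0]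
  have cres : ∀ f : PowerSeries L, PowerSeries.constantCoeff (PowerSeries.rescale q f) = PowerSeries.constantCoeff f := by
    intro f
    rw [← PowerSeries.coeff_zero_eq_constantCoeff_apply, PowerSeries.coeff_rescale]; simp
  obtain ⟨κ1, κ2, hκ2, hE⟩ : ∃ κ1 κ2 : L, κ2 ≠ 0 ∧ PowerSeries.C κ1 * (PowerSeries.rescale q Fm * a * PowerSeries.rescale q b) =
      PowerSeries.C κ2 * (Fm * PowerSeries.rescale q a * b) := by
    refine ⟨(1 - (q - 1) * p (-1)) * (∏ i, (- x i)) * ∏ i, (q⁻¹ * y i), (∏ i, (q⁻¹ * - x i)) * ∏ i, y i, ?_, ?_⟩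
    · refine mul_ne_zero (Finset.prod_ne_zero_iff.2 fun i _ => ?_) (Finset.prod_ne_zero_iff.2 fun i _ => hy i)
      exact mul_ne_zero (inv_ne_zero hq0) (neg_ne_zero.2 (hx i))
    · simp only [map_mul PowerSeries.C]
      linear_combination Fm * hB - (PowerSeries.C (∏ i, (- x i)) * a * (PowerSeries.C (∏ i, (q⁻¹ * y i)) * PowerSeries.rescale q b)) * hFG
  have hκeq : κ1 = κ2 := by
    have := congrArg PowerSeries.constantCoeff hE
    simpa [cres, ca, cb, cF] using this
  rw [hκeq] at hE
  have hE' : PowerSeries.rescale q Fm * a * PowerSeries.rescale q b = Fm * PowerSeries.rescale q a * b := by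
    refine mul_left_cancel₀ ?_ hE
    intro h
    have := congrArg PowerSeries.constantCoeff h
    simp [hκ2] at this
  have hainv : a * a⁻¹ = 1 := PowerSeries.mul_inv_cancel a (by rw [ca]; exact one_ne_zero)
  have hΩ : PowerSeries.rescale q (Fm * b * a⁻¹) = Fm * b * a⁻¹ := by
    have h := congrArg (PowerSeries.rescale q) hainv
    rw [map_mul, map_one] at h
    rw [map_mul, map_mul]
    generalize PowerSeries.rescale q a⁻¹ = A at *
    generalize PowerSeries.rescale q a = B at *
    linear_combination (a⁻¹ * A) * hE' + Fm * b * a⁻¹ * h - PowerSeries.rescale q Fm * PowerSeries.rescale q b * A * hainv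
  have hΩ1 : Fm * b * a⁻¹ = 1 := by
    ext k
    rcases k with _ | k
    · simp [ca, cb, cF]
    · have := congrArg (PowerSeries.coeff (k + 1)) hΩ
      rw [PowerSeries.coeff_rescale] at this
      have h2 : (q ^ (k + 1) - 1) * PowerSeries.coeff (k + 1) (Fm * b * a⁻¹) = 0 := by
        linear_combination this
      rcases mul_eq_zero.1 h2 with h | h
      · exact absurd (sub_eq_zero.1 h) (hq k)
      · rw [h]; simp [PowerSeries.coeff_one]
  have hfin : Fm * b = a := by linear_combination a * hΩ1 - Fm * b * hainv
  have := congrArg (PowerSeries.rescale (-1 : L)) hfin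
  rw [map_mul, hFm, hb, ha, auxE_rescale, auxE_rescale, PowerSeries.rescale_rescale] at this
  simpa using this

theorem aux_common_field (K : Type) [Field K] [CharZero K] :
    ∃ (L : Type) (_ : Field L), Nonempty (K →+* L) ∧ Nonempty (ℝ →+* L) := by
  obtain ⟨M, hM⟩ := Ideal.exists_maximal (K ⊗[ℚ] ℝ)
  refine ⟨(K ⊗[ℚ] ℝ) ⧸ M, Ideal.Quotient.field M, ⟨?_⟩, ⟨?_⟩⟩
  · exact (Ideal.Quotient.mk M).comp
      (Algebra.TensorProduct.includeLeft : K →ₐ[ℚ] K ⊗[ℚ] ℝ).toRingHom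
  · exact (Ideal.Quotient.mk M).comp
      (Algebra.TensorProduct.includeRight : ℝ →ₐ[ℚ] K ⊗[ℚ] ℝ).toRingHom

theorem aux_combine {K : Type} [Field K] [CharZero K] (q : K) (hq0 : q ≠ 0)
    (hq : ∀ k : ℕ, q ^ (k + 1) ≠ 1)
    (p : ℤ → K) (d : ℕ) (c : ℕ → K) (hc : c 0 ≠ 0)
    (hrec : ∀ k : ℤ, ∑ r ∈ Finset.range (d + 1), c r * p (k + r) = 0)
    (hN : ∀ k : ℕ, p (-1 - ((k + 1 : ℕ) : ℤ)) = q⁻¹ ^ (k + 1) * p k -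
      (q - 1) * ∑ t ∈ Finset.HasAntidiagonal.antidiagonal k, p (-1 - (t.1 : ℤ)) * (q⁻¹ ^ (t.2 + 1) * p t.2))
    (dm : ℕ → ℕ) (h0 : dm 0 = 1)
    (hNewton : ∀ k : ℕ, (1 - q⁻¹ ^ (k + 1)) * (dm (k + 1) : K) =
      (1 - q⁻¹) * ∑ t ∈ Finset.HasAntidiagonal.antidiagonal k, (-q⁻¹) ^ t.1 * p t.1 * dm t.2)
    {m n : ℕ} (x : Fin m → ℝ) (y : Fin n → ℝ) (hx : ∀ i, 0 < x i) (hy : ∀ i, 0 < y i)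
    (heq : (PowerSeries.mk fun l => (dm l : ℝ)) * auxE (fun i => - y i) = auxE x) :
    (PowerSeries.mk fun l => (dm l : ℝ)) * auxE (fun i => - (y i)⁻¹) = auxE (fun i => (x i)⁻¹) := by
  obtain ⟨L, _, ⟨f⟩, ⟨g⟩⟩ := aux_common_field K
  have hE : ∀ (k : ℕ) (z : Fin k → ℝ), PowerSeries.map g (auxE z) = auxE (fun i => g (z i)) := by
    intro k z
    unfold auxE
    rw [map_prod]
    simp
  have hmk : PowerSeries.map g (PowerSeries.mk fun l => (dm l : ℝ)) = PowerSeries.mk fun l => (dm l : L) := by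
    ext l
    simp
  apply PowerSeries.map_injective g g.injective
  have heq' := congrArg (PowerSeries.map g) heq
  rw [map_mul, hE, hE, hmk] at heq' ⊢
  simp only [map_neg, map_inv₀] at heq' ⊢
  refine aux_series (f q) (by simpa using hq0) ?_ (fun k => f (p k)) d (fun r => f (c r)) (by simpa using hc) ?_ ?_
    (fun l => (dm l : L)) (by simp [h0]) ?_ (fun i => g (x i)) (fun i => g (y i)) (fun i => by simpa using (hx i).ne')
    (fun i => by simpa using (hy i).ne') heq'
  · intro k h
    rw [← map_pow] at h
    exact hq k (f.injective (by rw [h, map_one]))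
  · intro k
    have := congrArg f (hrec k)
    simpa using this
  · intro k
    have := congrArg f (hN k)
    simpa using this
  · intro k
    have := congrArg f (hNewton k)
    simpa using this

section AuxTrace

variable {K : Type} [Field K] {V : Type} [AddCommGroup V] [Module K V]

theorem aux_decomp [FiniteDimensional K V] (R : V ⊗[K] V →ₗ[K] V ⊗[K] V) :
    ∃ (N : ℕ) (f g : Fin N → Module.End K V), R = ∑ i, TensorProduct.map (f i) (g i) := by
  obtain ⟨t, rfl⟩ := (homTensorHomEquiv K V V V V).surjective R
  induction t using TensorProduct.induction_on with
  | zero => exact ⟨0, 0, 0, by simp⟩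
  | tmul a b => exact ⟨1, fun _ => a, fun _ => b, by simp⟩
  | add s t hs ht =>
    obtain ⟨N, f, g, h⟩ := hs
    obtain ⟨N', f', g', h'⟩ := ht
    refine ⟨N + N', Fin.append f f', Fin.append g g', ?_⟩
    rw [map_add, h, h', Fin.sum_univ_add]
    simp

/-- partial trace operator attached to a decomposition -/
def auxRop {ι : Type} [Fintype ι] (f g : ι → Module.End K V) :
    Module.End K V →ₗ[K] Module.End K V :=
  ∑ i, (LinearMap.trace K V ∘ₗ LinearMap.mulLeft K (f i)).smulRight (g i)

theorem auxRop_apply {ι : Type} [Fintype ι] (f g : ι → Module.End K V) (β : Module.End K V) :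
    auxRop f g β = ∑ i, LinearMap.trace K V (f i * β) • g i := by
  simp [auxRop, LinearMap.sum_apply]

theorem auxRop_adj {ι : Type} [Fintype ι] (f g : ι → Module.End K V) (Z β : Module.End K V) :
    LinearMap.trace K V (Z * auxRop f g β) = LinearMap.trace K V (auxRop g f Z * β) := by
  rw [auxRop_apply, auxRop_apply, Finset.mul_sum, Finset.sum_mul, map_sum, map_sum]
  refine Finset.sum_congr rfl fun i _ => ?_
  rw [mul_smul_comm, smul_mul_assoc, map_smul, map_smul, smul_eq_mul, smul_eq_mul,
    LinearMap.trace_mul_comm K Z, mul_comm]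

variable [FiniteDimensional K V]

theorem aux_trace_ext {X X' : Module.End K V}
    (h : ∀ Y : Module.End K V, LinearMap.trace K V (X * Y) = LinearMap.trace K V (X' * Y)) :
    X = X' := by
  ext v
  rw [← sub_eq_zero, ← Module.forall_dual_apply_eq_zero_iff K]
  intro ζ
  have := h (ζ.smulRight v)
  have e : ∀ X : Module.End K V, X * (ζ.smulRight v) = ζ.smulRight (X v) := by
    intro X; ext w; simp
  rw [e, e, LinearMap.trace_smulRight, LinearMap.trace_smulRight] at this
  rw [map_sub, this, sub_self]

theorem aux_trace_sum {ι : Type} [Fintype ι] [DecidableEq ι] (b : Module.Basis ι K V)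
    (X : Module.End K V) : LinearMap.trace K V X = ∑ r, b.coord r (X (b r)) := by
  rw [LinearMap.trace_eq_matrix_trace K b, Matrix.trace]
  simp [LinearMap.toMatrix_apply]

theorem auxRop_surj {ι : Type} [Fintype ι] (f g : ι → Module.End K V)
    (h : Function.Bijective (auxRop f g)) : Function.Surjective (auxRop g f) := by
  rw [← LinearMap.injective_iff_surjective]
  rw [injective_iff_map_eq_zero]
  intro Z hZ
  apply aux_trace_ext
  intro Y
  obtain ⟨β, rfl⟩ := h.2 Y
  rw [auxRop_adj, hZ, zero_mul, zero_mul]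

theorem aux_bij {ι : Type} [Fintype ι] (f g : ι → Module.End K V)
    (Rs : Module.Dual K V ⊗[K] V →ₗ[K] V ⊗[K] Module.Dual K V)
    (hb : Function.Bijective Rs)
    (h : ∀ (ξ : Module.Dual K V) (v w : V),
      dualTensorHom K V V ((TensorProduct.comm K V (Module.Dual K V)) (Rs (ξ ⊗ₜ[K] v))) w =
        TensorProduct.lid K V (TensorProduct.map ξ LinearMap.id
          ((∑ i, TensorProduct.map (f i) (g i) : V ⊗[K] V →ₗ[K] V ⊗[K] V) (v ⊗ₜ[K] w)))) :
    Function.Bijective (auxRop f g) := by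
  have hd : Function.Bijective (dualTensorHom K V V) := by
    have := (dualTensorHomEquiv K V V).bijective
    exact this
  have key : auxRop f g ∘ₗ dualTensorHom K V V =
      dualTensorHom K V V ∘ₗ (TensorProduct.comm K V (Module.Dual K V)).toLinearMap ∘ₗ Rs := by
    ext ξ v w
    simp only [TensorProduct.AlgebraTensorModule.curry_apply, LinearMap.restrictScalars_self,
      TensorProduct.curry_apply, LinearMap.comp_apply, LinearEquiv.coe_coe]
    rw [h, auxRop_apply]
    have e : dualTensorHom K V V (ξ ⊗ₜ[K] v) = ξ.smulRight v := by ext w; simp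
    have e' : ∀ X : Module.End K V, X * (ξ.smulRight v) = ξ.smulRight (X v) := by
      intro X; ext w; simp
    rw [e]
    simp only [e', LinearMap.trace_smulRight]
    simp [LinearMap.sum_apply]
  have : Function.Bijective (auxRop f g ∘ₗ dualTensorHom K V V) := by
    rw [key]
    simp only [LinearMap.coe_comp]
    exact hd.comp ((TensorProduct.comm K V (Module.Dual K V)).bijective.comp hb)
  rw [LinearMap.coe_comp] at this
  exact (Function.Bijective.of_comp_iff _ hd).1 this

end AuxTrace

section AuxN

variable {K : Type} [Field K] {V : Type} [AddCommGroup V] [Module K V] [FiniteDimensional K V]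

theorem aux_b {ι κ : Type} [Fintype ι] [Fintype κ] (f g : ι → Module.End K V)
    (f' g' : κ → Module.End K V)
    (hinv : (∑ l, TensorProduct.map (f' l) (g' l) : Module.End K (V ⊗[K] V)) *
      (∑ i, TensorProduct.map (f i) (g i) : Module.End K (V ⊗[K] V)) = 1)
    (hyb : (∑ i, ∑ j, ∑ l, TensorProduct.map (TensorProduct.map (f i * f' l) (g i * f j * g' l)) (g j) :
        Module.End K ((V ⊗[K] V) ⊗[K] V)) =
      ∑ l, ∑ i, ∑ j, TensorProduct.map (TensorProduct.map (f i) (f' l * g i * f j)) (g' l * g j))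
    (hb : Function.Bijective (auxRop f g))
    (B : Module.End K V) (hB : auxRop f g B = 1) (Z : Module.End K V) :
    ∑ i, ∑ l, LinearMap.trace K V (f i * f' l * B) • (g i * Z * g' l) =
      LinearMap.trace K V (Z * B) • 1 := by
  obtain ⟨β, rfl⟩ := auxRop_surj f g hb Z
  apply aux_trace_ext
  intro Y
  rw [← auxRop_adj, hB, mul_one, smul_mul_assoc, one_mul, map_smul, smul_eq_mul]
  have h := congrArg (fun X : Module.End K ((V ⊗[K] V) ⊗[K] V) =>
    LinearMap.trace K _ (X * TensorProduct.map (TensorProduct.map B Y) β)) hyb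
  simp only [Finset.sum_mul, ← TensorProduct.map_mul, map_sum, LinearMap.trace_tensorProduct'] at h
  have hi := congrArg (fun X : Module.End K (V ⊗[K] V) =>
    LinearMap.trace K _ (X * TensorProduct.map Y β)) hinv
  simp only [Finset.sum_mul, Finset.mul_sum, ← TensorProduct.map_mul, map_sum, LinearMap.trace_tensorProduct',
    one_mul] at hi
  calc _ = ∑ i, ∑ j, ∑ l, LinearMap.trace K V (f i * f' l * B) * LinearMap.trace K V (g i * f j * g' l * Y) *
        LinearMap.trace K V (g j * β) := by
        simp only [Finset.sum_mul, map_sum, smul_mul_assoc, map_smul, smul_eq_mul, auxRop_apply,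
          Finset.mul_sum, mul_smul_comm]
        refine Finset.sum_congr rfl fun i _ => ?_
        rw [Finset.sum_comm]
        refine Finset.sum_congr rfl fun j _ => Finset.sum_congr rfl fun l _ => ?_
        ring
    _ = _ := h
    _ = ∑ l, ∑ j, LinearMap.trace K V (f' l * auxRop f g B * f j * Y) * LinearMap.trace K V (g' l * g j * β) := by
        refine Finset.sum_congr rfl fun l _ => ?_
        rw [Finset.sum_comm]
        refine Finset.sum_congr rfl fun j _ => ?_
        simp only [Finset.sum_mul, map_sum, smul_mul_assoc, map_smul, smul_eq_mul, auxRop_apply,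
          Finset.mul_sum, mul_smul_comm]
    _ = _ := by
        rw [hB]
        simp only [mul_one]
        first
        | rw [hi, mul_comm]
        | rw [Finset.sum_comm, hi, mul_comm]

theorem aux_c {ι κ : Type} [Fintype ι] [Fintype κ] (f g : ι → Module.End K V)
    (f' g' : κ → Module.End K V) (B : Module.End K V)
    (hb : ∀ Z : Module.End K V, ∑ i, ∑ l, LinearMap.trace K V (f i * f' l * B) • (g i * Z * g' l) =
      LinearMap.trace K V (Z * B) • 1) (Z : Module.End K V) :
    auxRop f g (auxRop g' f' Z * B) = Z * B := by
  set b := Module.finBasis K V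
  ext z
  have h : ∀ r, ∑ i, ∑ l, LinearMap.trace K V (f i * f' l * B) • (b.coord r (g' l (Z (b r))) • g i z) =
      b.coord r (B z) • Z (b r) := by
    intro r
    have := LinearMap.congr_fun (hb ((b.coord r).smulRight z)) (Z (b r))
    have e : ((b.coord r).smulRight z : Module.End K V) * B = ((b.coord r) ∘ₗ B).smulRight z := by
      ext w; simp
    rw [e, LinearMap.trace_smulRight] at this
    simpa [LinearMap.sum_apply] using this
  calc auxRop f g (auxRop g' f' Z * B) z
      = ∑ i, ∑ l, LinearMap.trace K V (f i * f' l * B) • (LinearMap.trace K V (g' l * Z) • g i z) := by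
        rw [auxRop_apply f g, LinearMap.sum_apply]
        refine Finset.sum_congr rfl fun i _ => ?_
        rw [LinearMap.smul_apply, auxRop_apply, Finset.sum_mul, Finset.mul_sum, map_sum, Finset.sum_smul]
        refine Finset.sum_congr rfl fun l _ => ?_
        rw [smul_mul_assoc, mul_smul_comm, map_smul, smul_eq_mul, smul_smul, mul_comm, mul_assoc]
    _ = ∑ r, ∑ i, ∑ l, LinearMap.trace K V (f i * f' l * B) • (b.coord r (g' l (Z (b r))) • g i z) := by
        symm
        rw [Finset.sum_comm]
        refine Finset.sum_congr rfl fun i _ => ?_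
        rw [Finset.sum_comm]
        refine Finset.sum_congr rfl fun l _ => ?_
        rw [← Finset.smul_sum, ← Finset.sum_smul, aux_trace_sum b (g' l * Z)]
        rfl
    _ = ∑ r, b.coord r (B z) • Z (b r) := Finset.sum_congr rfl fun r _ => h r
    _ = Z (∑ r, b.coord r (B z) • b r) := by simp only [map_sum, map_smul]
    _ = (Z * B) z := by
        rw [show ∑ r, b.coord r (B z) • b r = B z from b.sum_repr (B z)]
        rfl

theorem aux_N {ι κ : Type} [Fintype ι] [Fintype κ] (q : K) (f g : ι → Module.End K V)
    (f' g' : κ → Module.End K V)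
    (u : Module.End K V ≃ₗ[K] Module.End K V) (hu : ∀ X, u X = auxRop f g X)
    (hc : ∀ Z : Module.End K V, auxRop f g (auxRop g' f' Z * u.symm 1) = Z * u.symm 1)
    (hp : ∀ X : Module.End K V, auxRop f' g' X = q⁻¹ • (auxRop f g X - ((q - 1) * LinearMap.trace K V X) • 1))
    (k : ℕ) :
    LinearMap.trace K V ((u ^ (-1 - ((k + 1 : ℕ) : ℤ))) 1) = q⁻¹ ^ (k + 1) * LinearMap.trace K V ((u ^ (k : ℤ)) 1) -
      (q - 1) * ∑ t ∈ Finset.HasAntidiagonal.antidiagonal k, LinearMap.trace K V ((u ^ (-1 - (t.1 : ℤ))) 1) *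
        (q⁻¹ ^ (t.2 + 1) * LinearMap.trace K V ((u ^ (t.2 : ℤ)) 1)) := by
  set p : ℤ → K := fun k => LinearMap.trace K V ((u ^ k) 1) with hpdef
  set B := u.symm 1 with hB
  set S := auxRop f' g' with hS
  have hinv : ∀ X, (u⁻¹) X = u.symm X := fun X => rfl
  have hneg : ∀ j : ℕ, (u ^ (-1 - (j : ℤ))) 1 = ((auxRop g' f') ^ j) 1 * B := by
    intro j
    induction j with
    | zero => simp [hB, hinv]
    | succ j ih =>
      rw [show -1 - ((j + 1 : ℕ) : ℤ) = -1 + (-1 - (j : ℤ)) by push_cast; ring, zpow_add, zpow_neg_one]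
      rw [LinearEquiv.mul_apply, ih, hinv, LinearEquiv.symm_apply_eq, hu, pow_succ', Module.End.mul_apply, hc]
  have hadj : ∀ (j : ℕ) (X Y : Module.End K V), LinearMap.trace K V (((auxRop g' f') ^ j) X * Y) =
      LinearMap.trace K V (X * (S ^ j) Y) := by
    intro j
    induction j with
    | zero => intro X Y; simp
    | succ j ih =>
      intro X Y
      rw [pow_succ, Module.End.mul_apply, ih, ← auxRop_adj, pow_succ', Module.End.mul_apply]
  have hNj : ∀ j : ℕ, p (-1 - (j : ℤ)) = LinearMap.trace K V ((S ^ j) B) := by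
    intro j
    simp only [hpdef]
    rw [hneg, hadj, one_mul]
  have he : ∀ (k : ℕ) (i : ℕ), LinearMap.trace K V ((u ^ (i : ℤ)) ((S ^ (k + 1)) B)) = q⁻¹ ^ (k + 1) * p (k + i) -
      (q - 1) * ∑ t ∈ Finset.HasAntidiagonal.antidiagonal k, p (-1 - (t.1 : ℤ)) * (q⁻¹ ^ (t.2 + 1) * p (t.2 + i)) := by
    have hstep : ∀ (k i : ℕ), LinearMap.trace K V ((u ^ (i : ℤ)) ((S ^ (k + 1)) B)) =
        q⁻¹ * (LinearMap.trace K V ((u ^ ((i + 1 : ℕ) : ℤ)) ((S ^ k) B)) - (q - 1) * p (-1 - (k : ℤ)) * p i) := by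
      intro k i
      rw [pow_succ', Module.End.mul_apply, hp, ← hu, map_smul, map_smul, map_sub, map_smul, map_sub, map_smul,
        ← hNj]
      have : (u ^ ((i + 1 : ℕ) : ℤ)) ((S ^ k) B) = (u ^ (i : ℤ)) (u ((S ^ k) B)) := by
        rw [← LinearEquiv.mul_apply, ← zpow_add_one]; norm_cast
      rw [this]
      simp only [hpdef, smul_eq_mul]
    intro k
    induction k with
    | zero =>
      intro i
      rw [hstep]
      have : (u ^ ((i + 1 : ℕ) : ℤ)) ((S ^ 0) B) = (u ^ (i : ℤ)) 1 := by
        push_cast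
        rw [zpow_add_one, LinearEquiv.mul_apply]
        simp [hB]
      rw [this]
      simp [hpdef]
      ring
    | succ k ih =>
      intro i
      rw [hstep, ih, Finset.Nat.antidiagonal_succ', Finset.sum_cons]
      simp only [Finset.sum_map, Function.Embedding.prodMap, Function.Embedding.coeFn_mk, Prod.map,
        Function.Embedding.refl_apply, Nat.succ_eq_add_one]
      have e1 : ∑ t ∈ Finset.HasAntidiagonal.antidiagonal k, p (-1 - (t.1 : ℤ)) * (q⁻¹ ^ (t.2 + 1 + 1) * p (((t.2 + 1 : ℕ) : ℤ) + i)) =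
         q⁻¹ * ∑ t ∈ Finset.HasAntidiagonal.antidiagonal k, p (-1 - (t.1 : ℤ)) * (q⁻¹ ^ (t.2 + 1) * p (t.2 + ((i + 1 : ℕ) : ℤ))) := by
        rw [Finset.mul_sum]
        refine Finset.sum_congr rfl fun t _ => ?_
        rw [show ((t.2 + 1 : ℕ) : ℤ) + i = t.2 + ((i + 1 : ℕ) : ℤ) by push_cast; ring]
        ring
      rw [e1, show ((k + 1 : ℕ) : ℤ) + i = k + ((i + 1 : ℕ) : ℤ) by push_cast; ring]
      simp only [Nat.cast_zero, zero_add]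
      ring
  have h := he k 0
  rw [Nat.cast_zero, zpow_zero, show (1 : Module.End K V ≃ₗ[K] Module.End K V) ((S ^ (k + 1)) B) = (S ^ (k + 1)) B from rfl,
    ← hNj] at h
  simpa only [add_zero] using h

end AuxN

section AuxTP

variable {K : Type} [Field K] {V : Type} [AddCommGroup V] [Module K V] [FiniteDimensional K V]

theorem aux_assoc_conj (a b : Module.End K V) :
    (TensorProduct.assoc K V V V).symm.toLinearMap ∘ₗ
        TensorProduct.map LinearMap.id (TensorProduct.map a b) ∘ₗ (TensorProduct.assoc K V V V).toLinearMap =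
      TensorProduct.map (TensorProduct.map 1 a) b := by
  ext u v w
  simp

theorem aux_R1 {ι : Type} [Fintype ι] (f g : ι → Module.End K V) :
    TensorProduct.map (∑ i, TensorProduct.map (f i) (g i)) (LinearMap.id : V →ₗ[K] V) =
      ∑ i, TensorProduct.map (TensorProduct.map (f i) (g i)) (1 : Module.End K V) := by
  ext u v w
  simp [LinearMap.sum_apply, TensorProduct.sum_tmul]

theorem aux_R2 {ι : Type} [Fintype ι] (f g : ι → Module.End K V) :
    (TensorProduct.assoc K V V V).symm.toLinearMap ∘ₗ
        TensorProduct.map (LinearMap.id : V →ₗ[K] V) (∑ i, TensorProduct.map (f i) (g i)) ∘ₗ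
          (TensorProduct.assoc K V V V).toLinearMap =
      ∑ i, TensorProduct.map (TensorProduct.map (1 : Module.End K V) (f i)) (g i) := by
  ext u v w
  simp [LinearMap.sum_apply, TensorProduct.tmul_sum]

theorem aux_R2_mul (X Y : Module.End K (V ⊗[K] V)) (h : X * Y = 1) :
    ((TensorProduct.assoc K V V V).symm.toLinearMap ∘ₗ
        TensorProduct.map (LinearMap.id : V →ₗ[K] V) X ∘ₗ
          (TensorProduct.assoc K V V V).toLinearMap) ∘ₗ
    ((TensorProduct.assoc K V V V).symm.toLinearMap ∘ₗ
        TensorProduct.map (LinearMap.id : V →ₗ[K] V) Y ∘ₗ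
          (TensorProduct.assoc K V V V).toLinearMap) = LinearMap.id := by
  have h' : ∀ z, X (Y z) = z := fun z => LinearMap.congr_fun h z
  ext u v w
  simp [h']

theorem aux_hecke {A : Type*} [Ring A] [Algebra K A] (q : K) (hq0 : q ≠ 0) (R : A)
    (h : (R + 1) * (R - q • 1) = 0) :
    (q⁻¹ • R - (q⁻¹ * (q - 1)) • 1) * R = 1 ∧ R * (q⁻¹ • R - (q⁻¹ * (q - 1)) • 1) = 1 := by
  have hH' : R * R = (q - 1) • R + q • 1 := by
    rw [add_mul, mul_sub, mul_sub, one_mul, mul_smul_comm, mul_one, mul_smul_comm, mul_one] at h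
    rw [← sub_eq_zero, ← h, sub_smul, one_smul]
    abel
  constructor
  · rw [sub_mul, smul_mul_assoc, hH', smul_mul_assoc, one_mul, smul_add, smul_smul, smul_smul,
      inv_mul_cancel₀ hq0, one_smul, add_sub_cancel_left]
  · rw [mul_sub, mul_smul_comm, hH', mul_smul_comm, mul_one, smul_add, smul_smul, smul_smul,
      inv_mul_cancel₀ hq0, one_smul, add_sub_cancel_left]

theorem aux_hyb {ι κ : Type} [Fintype ι] [Fintype κ] (f g : ι → Module.End K V)
    (f' g' : κ → Module.End K V) (R R' : Module.End K (V ⊗[K] V))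
    (hfg : R = ∑ i, TensorProduct.map (f i) (g i)) (hfg' : R' = ∑ i, TensorProduct.map (f' i) (g' i))
    (hinv : R' * R = 1) (hinv' : R * R' = 1)
    (hbr : TensorProduct.map R LinearMap.id ∘ₗ
      ((TensorProduct.assoc K V V V).symm.toLinearMap ∘ₗ
        TensorProduct.map LinearMap.id R ∘ₗ (TensorProduct.assoc K V V V).toLinearMap) ∘ₗ
      TensorProduct.map R LinearMap.id =
    ((TensorProduct.assoc K V V V).symm.toLinearMap ∘ₗ
        TensorProduct.map LinearMap.id R ∘ₗ (TensorProduct.assoc K V V V).toLinearMap) ∘ₗ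
      TensorProduct.map R LinearMap.id ∘ₗ
      ((TensorProduct.assoc K V V V).symm.toLinearMap ∘ₗ
        TensorProduct.map LinearMap.id R ∘ₗ (TensorProduct.assoc K V V V).toLinearMap)) :
    (∑ i, ∑ j, ∑ l, TensorProduct.map (TensorProduct.map (f i * f' l) (g i * f j * g' l)) (g j) :
        Module.End K ((V ⊗[K] V) ⊗[K] V)) =
      ∑ l, ∑ i, ∑ j, TensorProduct.map (TensorProduct.map (f i) (f' l * g i * f j)) (g' l * g j) := by
  have i1 : TensorProduct.map R (1 : Module.End K V) * TensorProduct.map R' (1 : Module.End K V) = 1 := by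
    rw [← TensorProduct.map_mul, hinv', mul_one, TensorProduct.map_one]
  have i2 := aux_R2_mul R' R hinv
  change TensorProduct.map R LinearMap.id ∘ₗ TensorProduct.map R' LinearMap.id = LinearMap.id at i1
  rw [hfg, hfg', aux_R1, aux_R1] at i1
  rw [hfg, hfg', aux_R2, aux_R2] at i2
  rw [hfg, aux_R1, aux_R2] at hbr
  have key : ∀ (R1 R2 R1' R2' : Module.End K ((V ⊗[K] V) ⊗[K] V)), R1 ∘ₗ R2 ∘ₗ R1 = R2 ∘ₗ R1 ∘ₗ R2 →
      R1 ∘ₗ R1' = LinearMap.id → R2' ∘ₗ R2 = LinearMap.id → R1 * (R2 * R1') = R2' * (R1 * R2) := by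
    intro R1 R2 R1' R2' hb i1 i2
    replace hb : R1 * (R2 * R1) = R2 * (R1 * R2) := hb
    replace i1 : R1 * R1' = 1 := i1
    replace i2 : R2' * R2 = 1 := i2
    calc R1 * (R2 * R1') = R2' * R2 * (R1 * (R2 * R1')) := by rw [i2, one_mul]
      _ = R2' * (R2 * (R1 * R2)) * R1' := by simp only [mul_assoc]
      _ = R2' * (R1 * R2) * (R1 * R1') := by rw [← hb]; simp only [mul_assoc]
      _ = R2' * (R1 * R2) := by rw [i1, mul_one]
  have key := key _ _ _ _ hbr i1 i2
  simp only [Finset.sum_mul_sum] at key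
  simp only [Finset.mul_sum, ← TensorProduct.map_mul, mul_one, one_mul, ← mul_assoc] at key
  exact key

theorem aux_rec (T : Module.End K V →ₗ[K] Module.End K V) (u : Module.End K V ≃ₗ[K] Module.End K V)
    (hu : ∀ X, u X = T X) (p : ℤ → K) (hp : ∀ k, p k = LinearMap.trace K V ((u ^ k) 1)) :
    T.charpoly.coeff 0 ≠ 0 ∧
    (∀ k : ℤ, ∑ r ∈ Finset.range (T.charpoly.natDegree + 1), T.charpoly.coeff r * p (k + r) = 0) ∧
    ∀ j : ℕ, p j = LinearMap.trace K V ((T ^ j) 1) := by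
  have hpow : ∀ (r : ℕ) (X : Module.End K V), (u ^ (r : ℤ)) X = (T ^ r) X := by
    intro r
    induction r with
    | zero => intro X; rfl
    | succ r ih =>
      intro X
      rw [Nat.cast_succ, zpow_add_one, pow_succ, LinearEquiv.mul_apply, Module.End.mul_apply, ih, hu]
  refine ⟨?_, ?_, ?_⟩
  · intro h0
    have hdet : IsUnit (LinearMap.det (u : Module.End K V →ₗ[K] Module.End K V)) := LinearEquiv.isUnit_det' u
    have : (u : Module.End K V →ₗ[K] Module.End K V) = T := LinearMap.ext hu
    rw [this, LinearMap.det_eq_sign_charpoly_coeff, h0, mul_zero] at hdet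
    simp at hdet
  · intro k
    have h := LinearMap.aeval_self_charpoly T
    rw [Polynomial.aeval_eq_sum_range] at h
    have h2 := congrArg (LinearMap.trace K V) (LinearMap.congr_fun h ((u ^ k) 1))
    rw [LinearMap.sum_apply, map_sum] at h2
    rw [LinearMap.zero_apply, map_zero] at h2
    rw [← h2]
    refine Finset.sum_congr rfl fun r _ => ?_
    rw [LinearMap.smul_apply, map_smul, smul_eq_mul, hp, add_comm, zpow_add, LinearEquiv.mul_apply, hpow]
  · intro j
    rw [hp, hpow]

theorem aux_trace_part (q : K) (hq0 : q ≠ 0)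
    (R : V ⊗[K] V →ₗ[K] V ⊗[K] V) (hR : IsHeckeSymmetry K V q R)
    {N : ℕ} (f g : Fin N → Module.End K V) (hfg : R = ∑ i, TensorProduct.map (f i) (g i)) :
    ∃ (p : ℤ → K) (d : ℕ) (c : ℕ → K), c 0 ≠ 0 ∧
      (∀ k : ℤ, ∑ r ∈ Finset.range (d + 1), c r * p (k + r) = 0) ∧
      (∀ k : ℕ, p (-1 - ((k + 1 : ℕ) : ℤ)) = q⁻¹ ^ (k + 1) * p k -
        (q - 1) * ∑ t ∈ Finset.HasAntidiagonal.antidiagonal k,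
          p (-1 - (t.1 : ℤ)) * (q⁻¹ ^ (t.2 + 1) * p t.2)) ∧
      ∀ j : ℕ, p j = LinearMap.trace K V ((auxRop f g ^ j) 1) := by
  obtain ⟨-, hbr, hH, Rs, hRsb, hRs⟩ := hR
  rw [hfg] at hRs
  have hb := aux_bij f g Rs hRsb hRs
  obtain ⟨u, hu'⟩ : ∃ u : Module.End K V ≃ₗ[K] Module.End K V, ∀ X, u X = auxRop f g X :=
    ⟨LinearEquiv.ofBijective (auxRop f g) hb, fun X => rfl⟩
  obtain ⟨f', hf'⟩ : ∃ f' : Option (Fin N) → Module.End K V,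
    f' = fun o => o.elim ((-(q⁻¹ * (q - 1))) • 1) (fun i => q⁻¹ • f i) := ⟨_, rfl⟩
  obtain ⟨g', hg'⟩ : ∃ g' : Option (Fin N) → Module.End K V, g' = fun o => o.elim 1 g := ⟨_, rfl⟩
  obtain ⟨hinv, hinv'⟩ := aux_hecke (A := Module.End K (V ⊗[K] V)) q hq0 R hH
  have hR' : (q⁻¹ • R - (q⁻¹ * (q - 1)) • 1 : Module.End K (V ⊗[K] V)) = ∑ l, TensorProduct.map (f' l) (g' l) := by
    rw [Fintype.sum_option, hfg, Finset.smul_sum]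
    simp only [hf', hg', Option.elim, TensorProduct.map_smul_left, TensorProduct.map_one]
    module
  have hyb := aux_hyb f g f' g' R _ hfg hR' hinv hinv' hbr
  rw [hR'] at hinv
  have hinv2 : (∑ l, TensorProduct.map (f' l) (g' l) : Module.End K (V ⊗[K] V)) *
      (∑ i, TensorProduct.map (f i) (g i) : Module.End K (V ⊗[K] V)) = 1 := hfg ▸ hinv
  have hB : auxRop f g (u.symm 1) = 1 := by rw [← hu', LinearEquiv.apply_symm_apply]
  have hbb := aux_b f g f' g' hinv2 hyb hb (u.symm 1) hB
  have hc := aux_c f g f' g' (u.symm 1) hbb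
  have hp : ∀ X : Module.End K V, auxRop f' g' X = q⁻¹ • (auxRop f g X - ((q - 1) * LinearMap.trace K V X) • 1) := by
    intro X
    rw [auxRop_apply, auxRop_apply, Fintype.sum_option]
    simp only [hf', hg', Option.elim, smul_mul_assoc, one_mul, map_smul, smul_eq_mul]
    rw [smul_sub, Finset.smul_sum]
    simp only [smul_smul]
    rw [neg_mul, neg_smul, ← mul_assoc]
    abel
  obtain ⟨h1, h2, h3⟩ := aux_rec (auxRop f g) u hu' (fun k => LinearMap.trace K V ((u ^ k) 1)) (fun k => rfl)
  exact ⟨fun k => LinearMap.trace K V ((u ^ k) 1), (auxRop f g).charpoly.natDegree,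
    fun r => (auxRop f g).charpoly.coeff r, h1, h2, aux_N q f g f' g' u hu' hc hp, h3⟩

end AuxTP

section AuxTower

theorem aux_alg1 {K : Type} [Field K] {A : Type} [Ring A] [Algebra K A] (q a : K) (hq0 : q ≠ 0) (ha : a ≠ 0)
    (hb : 1 + q⁻¹ * a ≠ 0) (T f A2 : A) (hT : T * T = (q - 1) • T + q • 1) (hf : f * f = f)
    (hk : f * T * f * T = a⁻¹ • (f * T * T + f * T) - f * T * f)
    (hA : A2 = (1 + q⁻¹ * a)⁻¹ • (f - (q⁻¹ * a) • (f * T * f))) :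
    A2 * f = A2 ∧ A2 * T = - A2 ∧ A2 * A2 = A2 := by
  have h1 : A2 * f = A2 := by
    rw [hA, smul_mul_assoc, sub_mul, hf, smul_mul_assoc, mul_assoc (f * T), hf]
  have h2 : A2 * T = - A2 := by
    have e : f * T * T = (q - 1) • (f * T) + q • f := by
      rw [mul_assoc, hT, mul_add, mul_smul_comm, mul_smul_comm, mul_one]
    rw [hA, smul_mul_assoc, sub_mul, smul_mul_assoc, hk, e, ← smul_neg]
    congr 1
    have e2 : (q⁻¹ * a) * a⁻¹ * q = 1 := by field_simp
    have e1 : (q⁻¹ * a) * a⁻¹ * (q - 1) + (q⁻¹ * a) * a⁻¹ = 1 := by field_simp; ring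
    rw [smul_sub, smul_smul, smul_add, smul_add, smul_smul, smul_smul, e2]
    have : ((q⁻¹ * a) * a⁻¹ * (q - 1)) • (f * T) + (1 : K) • f + ((q⁻¹ * a) * a⁻¹) • (f * T) =
        ((q⁻¹ * a) * a⁻¹ * (q - 1) + (q⁻¹ * a) * a⁻¹) • (f * T) + f := by
      module
    rw [this, e1]
    module
  refine ⟨h1, h2, ?_⟩
  conv_lhs => rw [show A2 * A2 = A2 * ((1 + q⁻¹ * a)⁻¹ • (f - (q⁻¹ * a) • (f * T * f))) from by rw [← hA]]
  rw [mul_smul_comm, mul_sub, h1, mul_smul_comm, ← mul_assoc, ← mul_assoc, h1, h2, neg_mul, h1, smul_neg, sub_neg_eq_add]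
  rw [show A2 + (q⁻¹ * a) • A2 = (1 + q⁻¹ * a) • A2 by module, smul_smul, inv_mul_cancel₀ hb, one_smul]

theorem aux_alg2 {K : Type} [Field K] {A : Type} [Ring A] [Algebra K A] (s b : K)
    (T T1 f e : A) (hf : f = b • (e - s • (e * T1 * e))) (hfe : f * e = f) (hfT : f * T1 = - f)
    (heT : e * T = T * e) (hbr : T * T1 * T = T1 * T * T1) :
    f * T * f * T = b • (f * T * T + f * T) - f * T * f := by
  have h0 : f * T * e = f * T := by rw [mul_assoc, ← heT, ← mul_assoc, hfe]
  have h1 : f * T * f = b • (f * T - s • (f * T * T1 * e)) := by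
    conv_lhs => rw [show f * T * f = f * T * (b • (e - s • (e * T1 * e))) from by rw [← hf]]
    rw [mul_smul_comm, mul_sub, h0, mul_smul_comm, ← mul_assoc, ← mul_assoc, h0]
  have h2 : f * T * T1 * e * T = - (f * T * T1 * e) := by
    calc f * T * T1 * e * T = f * (T * T1 * T) * e := by
          rw [mul_assoc _ e T, heT]; simp only [mul_assoc]
      _ = (f * T1) * T * T1 * e := by rw [hbr]; simp only [mul_assoc]
      _ = _ := by rw [hfT]; simp only [neg_mul]
  rw [h1, smul_mul_assoc, sub_mul, smul_mul_assoc, h2]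
  module

end AuxTower

section AuxTowerT

variable {K : Type} [Field K] {V : Type} [AddCommGroup V] [Module K V]

/-- `R` acting on the first two factors -/
def auxT {N : ℕ} (f g : Fin N → Module.End K V) (Y : Type) [AddCommGroup Y] [Module K Y] :
    Module.End K (V ⊗[K] (V ⊗[K] Y)) :=
  ∑ i, TensorProduct.map (f i) (TensorProduct.map (g i) (1 : Module.End K Y))

theorem auxT_conj {N : ℕ} (f g : Fin N → Module.End K V) (Y : Type) [AddCommGroup Y] [Module K Y] :
    auxT f g Y = (TensorProduct.assoc K V V Y).conj
      (LinearMap.rTensor Y (∑ i, TensorProduct.map (f i) (g i))) := by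
  ext u v w
  simp [auxT, LinearMap.sum_apply, TensorProduct.sum_tmul, LinearEquiv.conj_apply]

theorem auxT_sq {N : ℕ} (f g : Fin N → Module.End K V) (Y : Type) [AddCommGroup Y] [Module K Y]
    (q : K) (R : Module.End K (V ⊗[K] V)) (hfg : R = ∑ i, TensorProduct.map (f i) (g i))
    (h : (R + 1) * (R - q • 1) = 0) :
    auxT f g Y * auxT f g Y = (q - 1) • auxT f g Y + q • 1 := by
  have hH' : R * R = (q - 1) • R + q • 1 := by
    rw [add_mul, mul_sub, mul_sub, one_mul, mul_smul_comm, mul_one, mul_smul_comm, mul_one] at h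
    rw [← sub_eq_zero]
    refine Eq.trans ?_ h
    module
  rw [auxT_conj, ← hfg]
  have := congrArg (fun X => (TensorProduct.assoc K V V Y).conj (LinearMap.rTensor Y X)) hH'
  simp only [LinearMap.rTensor_mul, LinearMap.rTensor_add, LinearMap.rTensor_smul, map_add, map_smul] at this
  rw [Module.End.mul_eq_comp, LinearEquiv.conj_comp] at this
  rw [Module.End.mul_eq_comp, this]
  congr 2
  rw [Module.End.one_eq_id, LinearMap.rTensor_id, LinearEquiv.conj_id]
  rfl

/-- conjugation to three factors -/
def auxPsi (Y : Type) [AddCommGroup Y] [Module K Y] (X : Module.End K ((V ⊗[K] V) ⊗[K] V)) :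
    Module.End K (V ⊗[K] (V ⊗[K] (V ⊗[K] Y))) :=
  ((TensorProduct.assoc K (V ⊗[K] V) V Y).trans (TensorProduct.assoc K V V (V ⊗[K] Y))).conj
    (LinearMap.rTensor Y X)

theorem auxPsi_comp (Y : Type) [AddCommGroup Y] [Module K Y] (X X' : Module.End K ((V ⊗[K] V) ⊗[K] V)) :
    auxPsi Y (X ∘ₗ X') = auxPsi Y X * auxPsi Y X' := by
  unfold auxPsi
  rw [LinearMap.rTensor_comp, LinearEquiv.conj_comp]
  rfl

theorem auxT_braid {N : ℕ} (f g : Fin N → Module.End K V) (Y : Type) [AddCommGroup Y] [Module K Y]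
    (R : Module.End K (V ⊗[K] V)) (hfg : R = ∑ i, TensorProduct.map (f i) (g i))
    (hbr : TensorProduct.map R LinearMap.id ∘ₗ
      ((TensorProduct.assoc K V V V).symm.toLinearMap ∘ₗ
        TensorProduct.map LinearMap.id R ∘ₗ (TensorProduct.assoc K V V V).toLinearMap) ∘ₗ
      TensorProduct.map R LinearMap.id =
    ((TensorProduct.assoc K V V V).symm.toLinearMap ∘ₗ
        TensorProduct.map LinearMap.id R ∘ₗ (TensorProduct.assoc K V V V).toLinearMap) ∘ₗ
      TensorProduct.map R LinearMap.id ∘ₗ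
      ((TensorProduct.assoc K V V V).symm.toLinearMap ∘ₗ
        TensorProduct.map LinearMap.id R ∘ₗ (TensorProduct.assoc K V V V).toLinearMap)) :
    auxT f g (V ⊗[K] Y) * TensorProduct.map 1 (auxT f g Y) * auxT f g (V ⊗[K] Y) =
      TensorProduct.map 1 (auxT f g Y) * auxT f g (V ⊗[K] Y) * TensorProduct.map 1 (auxT f g Y) := by
  have e1 : auxT f g (V ⊗[K] Y) = auxPsi Y (TensorProduct.map R LinearMap.id) := by
    rw [hfg]
    ext u v w y
    simp [auxT, auxPsi, LinearMap.sum_apply, TensorProduct.sum_tmul, LinearEquiv.conj_apply]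
  have e2 : TensorProduct.map 1 (auxT f g Y) = auxPsi Y ((TensorProduct.assoc K V V V).symm.toLinearMap ∘ₗ
        TensorProduct.map LinearMap.id R ∘ₗ (TensorProduct.assoc K V V V).toLinearMap) := by
    rw [hfg]
    ext u v w y
    simp [auxT, auxPsi, LinearMap.sum_apply, TensorProduct.sum_tmul, TensorProduct.tmul_sum, LinearEquiv.conj_apply]
  rw [e1, e2, mul_assoc, mul_assoc, ← auxPsi_comp, ← auxPsi_comp, ← auxPsi_comp, ← auxPsi_comp, hbr]

/-- commutation of `R` with operators on the last factor -/
theorem auxT_comm {N : ℕ} (f g : Fin N → Module.End K V) (Y : Type) [AddCommGroup Y] [Module K Y]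
    (B : Module.End K Y) :
    TensorProduct.map 1 (TensorProduct.map 1 B) * auxT f g Y =
      auxT f g Y * TensorProduct.map 1 (TensorProduct.map 1 B) := by
  unfold auxT
  rw [Finset.mul_sum, Finset.sum_mul]
  refine Finset.sum_congr rfl fun i _ => ?_
  rw [← TensorProduct.map_mul, ← TensorProduct.map_mul, ← TensorProduct.map_mul, ← TensorProduct.map_mul]
  simp only [mul_one, one_mul]

/-- a stage of the tower of antisymmetrizers -/
structure AuxStage (K : Type) [Field K] (V : Type) [AddCommGroup V] [Module K V] where
  Y : Type
  i1 : AddCommGroup Y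
  i2 : Module K Y
  i3 : FiniteDimensional K Y
  A : Module.End K Y
  A1 : Module.End K (V ⊗[K] Y)

attribute [instance] AuxStage.i1 AuxStage.i2 AuxStage.i3

/-- q-integers -/
def auxQ (q : K) (k : ℕ) : K := ∑ i ∈ Finset.range (k + 1), q⁻¹ ^ i

theorem auxQ_succ (q : K) (k : ℕ) : auxQ q (k + 1) = 1 + q⁻¹ * auxQ q k := by
  unfold auxQ
  rw [Finset.sum_range_succ', Finset.mul_sum, add_comm]
  simp [pow_succ']

theorem auxQ_zero (q : K) : auxQ q 0 = 1 := by simp [auxQ]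

theorem auxQ_mul (q : K) (k : ℕ) : (1 - q⁻¹) * auxQ q k = 1 - q⁻¹ ^ (k + 1) :=
  mul_neg_geom_sum _ _

theorem auxQ_ne (q : K) (hq : ∀ k : ℕ, q ^ (k + 1) ≠ 1) (k : ℕ) : auxQ q k ≠ 0 := by
  intro h
  have := auxQ_mul q k
  rw [h, mul_zero, eq_comm, sub_eq_zero, inv_pow] at this
  exact hq k (inv_eq_one.mp this.symm)

variable [FiniteDimensional K V]

/-- the next antisymmetrizer -/
def auxA2 {N : ℕ} (f g : Fin N → Module.End K V) (s : K) (Y : Type) [AddCommGroup Y] [Module K Y]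
    (B : Module.End K (V ⊗[K] Y)) : Module.End K (V ⊗[K] (V ⊗[K] Y)) :=
  (1 + s)⁻¹ • (TensorProduct.map 1 B - s • (TensorProduct.map 1 B * auxT f g Y * TensorProduct.map 1 B))

theorem aux_map_sub (Y : Type) [AddCommGroup Y] [Module K Y] (B C : Module.End K Y) :
    TensorProduct.map (1 : Module.End K V) (B - C) = TensorProduct.map 1 B - TensorProduct.map 1 C := by
  ext u v
  simp [TensorProduct.tmul_sub]

theorem aux_map_neg (Y : Type) [AddCommGroup Y] [Module K Y] (B : Module.End K Y) :
    TensorProduct.map (1 : Module.End K V) (- B) = - TensorProduct.map 1 B := by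
  ext u v
  simp [TensorProduct.tmul_neg]

/-- one step of the tower -/
def auxNext {N : ℕ} (f g : Fin N → Module.End K V) (s : K) (S : AuxStage K V) : AuxStage K V where
  Y := V ⊗[K] S.Y
  i1 := inferInstance
  i2 := inferInstance
  i3 := inferInstance
  A := S.A1
  A1 := auxA2 f g s S.Y S.A1

/-- the tower of antisymmetrizers -/
def auxS {N : ℕ} (f g : Fin N → Module.End K V) (q : K) : ℕ → AuxStage K V
  | 0 => { Y := K, i1 := inferInstance, i2 := inferInstance, i3 := inferInstance, A := 1, A1 := 1 }
  | k + 1 => auxNext f g (q⁻¹ * auxQ q k) (auxS f g q k)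

/-- invariant of the tower -/
def auxInv {N : ℕ} (f g : Fin N → Module.End K V) (a : K) (S : AuxStage K V) : Prop :=
  S.A * S.A = S.A ∧ S.A1 * S.A1 = S.A1 ∧
  (TensorProduct.map 1 S.A1 * auxT f g S.Y * TensorProduct.map 1 S.A1 * auxT f g S.Y =
    a⁻¹ • (TensorProduct.map 1 S.A1 * auxT f g S.Y * auxT f g S.Y + TensorProduct.map 1 S.A1 * auxT f g S.Y) -
      TensorProduct.map 1 S.A1 * auxT f g S.Y * TensorProduct.map 1 S.A1)

theorem auxNext_facts {N : ℕ} (f g : Fin N → Module.End K V) (q : K) (hq0 : q ≠ 0) 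
    (R : Module.End K (V ⊗[K] V)) (hfg : R = ∑ i, TensorProduct.map (f i) (g i))
    (h : (R + 1) * (R - q • 1) = 0) (a : K) (ha : a ≠ 0) (hb : 1 + q⁻¹ * a ≠ 0) (S : AuxStage K V)
    (hS : auxInv f g a S) (A2 : Module.End K (V ⊗[K] (V ⊗[K] S.Y)))
    (hA2 : A2 = auxA2 f g (q⁻¹ * a) S.Y S.A1) : A2 * TensorProduct.map 1 S.A1 = A2 ∧ A2 * auxT f g S.Y = - A2 ∧
      A2 * A2 = A2 := by
  refine aux_alg1 q a hq0 ha hb (auxT f g S.Y) (TensorProduct.map 1 S.A1) A2 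
    (auxT_sq f g S.Y q R hfg h) ?_ hS.2.2 hA2
  rw [← TensorProduct.map_mul, hS.2.1, one_mul]

theorem auxNext_inv {N : ℕ} (f g : Fin N → Module.End K V) (q : K) (hq0 : q ≠ 0) 
    (R : Module.End K (V ⊗[K] V)) (hfg : R = ∑ i, TensorProduct.map (f i) (g i))
    (h : (R + 1) * (R - q • 1) = 0) 
    (hbr : TensorProduct.map R LinearMap.id ∘ₗ
      ((TensorProduct.assoc K V V V).symm.toLinearMap ∘ₗ
        TensorProduct.map LinearMap.id R ∘ₗ (TensorProduct.assoc K V V V).toLinearMap) ∘ₗ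
      TensorProduct.map R LinearMap.id =
    ((TensorProduct.assoc K V V V).symm.toLinearMap ∘ₗ
        TensorProduct.map LinearMap.id R ∘ₗ (TensorProduct.assoc K V V V).toLinearMap) ∘ₗ
      TensorProduct.map R LinearMap.id ∘ₗ
      ((TensorProduct.assoc K V V V).symm.toLinearMap ∘ₗ
        TensorProduct.map LinearMap.id R ∘ₗ (TensorProduct.assoc K V V V).toLinearMap))
    (a : K) (ha : a ≠ 0) (hb : 1 + q⁻¹ * a ≠ 0) (S : AuxStage K V)
    (hS : auxInv f g a S) : auxInv f g (1 + q⁻¹ * a) (auxNext f g (q⁻¹ * a) S) := by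
  obtain ⟨h1, h2, h3⟩ := auxNext_facts f g q hq0 R hfg h a ha hb S hS _ rfl
  refine ⟨hS.2.1, h3, ?_⟩
  have := aux_alg2 (q⁻¹ * a) (1 + q⁻¹ * a)⁻¹ (auxT f g (V ⊗[K] S.Y)) (TensorProduct.map 1 (auxT f g S.Y))
    (TensorProduct.map 1 (auxA2 f g (q⁻¹ * a) S.Y S.A1)) (TensorProduct.map 1 (TensorProduct.map 1 S.A1))
  refine this ?_ ?_ ?_ ?_ ?_
  · simp only [auxA2, TensorProduct.map_smul_right, aux_map_sub, ← TensorProduct.map_mul, mul_one]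
  · rw [← TensorProduct.map_mul, mul_one]
    exact congrArg _ h1
  · rw [← TensorProduct.map_mul, mul_one]
    refine (congrArg _ h2).trans ?_
    exact aux_map_neg _ _
  · exact auxT_comm f g (V ⊗[K] S.Y) S.A1
  · exact auxT_braid f g S.Y R hfg hbr

end AuxTowerT

section AuxNewton

variable {K : Type} [Field K] {V : Type} [AddCommGroup V] [Module K V] [FiniteDimensional K V]

theorem auxA2_trace {N : ℕ} (f g : Fin N → Module.End K V) (s : K) (hs : 1 + s ≠ 0)
    (Y : Type) [AddCommGroup Y] [Module K Y] [FiniteDimensional K Y]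
    (B : Module.End K (V ⊗[K] Y)) (hB : B * B = B) (Q : Module.End K V) :
    (1 + s) * LinearMap.trace K _ (auxA2 f g s Y B * TensorProduct.map Q 1) =
      LinearMap.trace K V Q * LinearMap.trace K _ B -
      s * LinearMap.trace K _ (B * TensorProduct.map (auxRop f g Q) 1) := by
  unfold auxA2
  rw [smul_mul_assoc, map_smul, smul_eq_mul, ← mul_assoc, mul_inv_cancel₀ hs, one_mul, sub_mul, map_sub,
    smul_mul_assoc, map_smul, smul_eq_mul]
  have hc : TensorProduct.map 1 B * TensorProduct.map Q (1 : Module.End K (V ⊗[K] Y)) =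
      TensorProduct.map Q (1 : Module.End K (V ⊗[K] Y)) * TensorProduct.map 1 B := by
    rw [← TensorProduct.map_mul, ← TensorProduct.map_mul]; simp only [mul_one, one_mul]
  have hF : TensorProduct.map (1 : Module.End K V) B * TensorProduct.map 1 B = TensorProduct.map 1 B := by
    rw [← TensorProduct.map_mul, hB, one_mul]
  congr 1
  · rw [← TensorProduct.map_mul, one_mul, mul_one, LinearMap.trace_tensorProduct']
  · congr 1
    rw [mul_assoc, hc, ← mul_assoc, LinearMap.trace_mul_comm, ← mul_assoc, ← mul_assoc, hF]
    rw [auxRop_apply, auxT, Finset.mul_sum, Finset.sum_mul, map_sum]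
    have : TensorProduct.map (∑ i, LinearMap.trace K V (f i * Q) • g i) (1 : Module.End K Y) =
        ∑ i, LinearMap.trace K V (f i * Q) • TensorProduct.map (g i) (1 : Module.End K Y) := by
      ext u v
      simp [LinearMap.sum_apply, TensorProduct.sum_tmul, TensorProduct.smul_tmul']
    rw [this, Finset.mul_sum, map_sum]
    refine Finset.sum_congr rfl fun i _ => ?_
    rw [← TensorProduct.map_mul, ← TensorProduct.map_mul, one_mul, mul_one, LinearMap.trace_tensorProduct',
      mul_smul_comm, map_smul, smul_eq_mul]

/-- full tower facts -/
theorem auxS_inv {N : ℕ} (f g : Fin N → Module.End K V) (q : K) (hq0 : q ≠ 0)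
    (hq : ∀ k : ℕ, q ^ (k + 1) ≠ 1)
    (R : Module.End K (V ⊗[K] V)) (hfg : R = ∑ i, TensorProduct.map (f i) (g i))
    (hR : IsHeckeSymmetry K V q R) (k : ℕ) : auxInv f g (auxQ q k) (auxS f g q k) := by
  induction k with
  | zero =>
    refine ⟨one_mul _, one_mul _, ?_⟩
    have : TensorProduct.map (1 : Module.End K V) (auxS f g q 0).A1 = 1 := TensorProduct.map_one
    rw [this, auxQ_zero]
    simp
  | succ k ih =>
    have hb := auxQ_ne q hq (k + 1)
    rw [auxQ_succ] at hb ⊢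
    exact auxNext_inv f g q hq0 R hfg hR.2.2.1 hR.2.1 _ (auxQ_ne q hq k) hb _ ih

theorem auxS_facts {N : ℕ} (f g : Fin N → Module.End K V) (q : K) (hq0 : q ≠ 0)
    (hq : ∀ k : ℕ, q ^ (k + 1) ≠ 1)
    (R : Module.End K (V ⊗[K] V)) (hfg : R = ∑ i, TensorProduct.map (f i) (g i))
    (hR : IsHeckeSymmetry K V q R) (k : ℕ) (A2 : Module.End K (V ⊗[K] (V ⊗[K] (auxS f g q k).Y)))
    (hA2 : A2 = (auxS f g q (k + 1)).A1) :
    A2 * TensorProduct.map 1 (auxS f g q k).A1 = A2 ∧ A2 * auxT f g (auxS f g q k).Y = - A2 ∧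
      A2 * A2 = A2 := by
  have hb := auxQ_ne q hq (k + 1)
  rw [auxQ_succ] at hb
  exact auxNext_facts f g q hq0 R hfg hR.2.2.1 _ (auxQ_ne q hq k) hb _ 
    (auxS_inv f g q hq0 hq R hfg hR k) A2 hA2

/-- traces -/
def auxU {N : ℕ} (f g : Fin N → Module.End K V) (q : K) (k : ℕ) (Q : Module.End K V) : K :=
  LinearMap.trace K _ ((auxS f g q k).A1 * TensorProduct.map Q 1)

/-- traces -/
def auxL {N : ℕ} (f g : Fin N → Module.End K V) (q : K) (k : ℕ) : K :=
  LinearMap.trace K _ (auxS f g q k).A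

theorem auxL_zero {N : ℕ} (f g : Fin N → Module.End K V) (q : K) : auxL f g q 0 = 1 := by
  change LinearMap.trace K K 1 = 1
  rw [LinearMap.trace_one]
  simp

theorem auxU_one {N : ℕ} (f g : Fin N → Module.End K V) (q : K) (k : ℕ) :
    auxU f g q k 1 = auxL f g q (k + 1) := by
  unfold auxU
  rw [TensorProduct.map_one, mul_one]
  rfl

theorem auxU_zero {N : ℕ} (f g : Fin N → Module.End K V) (q : K) (Q : Module.End K V) :
    auxU f g q 0 Q = LinearMap.trace K V Q := by
  have : auxU f g q 0 Q = LinearMap.trace K (V ⊗[K] K) (1 * TensorProduct.map Q 1) := rfl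
  rw [this, one_mul, LinearMap.trace_tensorProduct', LinearMap.trace_one]
  simp

theorem auxU_succ {N : ℕ} (f g : Fin N → Module.End K V) (q : K) (hq0 : q ≠ 0)
    (hq : ∀ k : ℕ, q ^ (k + 1) ≠ 1)
    (R : Module.End K (V ⊗[K] V)) (hfg : R = ∑ i, TensorProduct.map (f i) (g i))
    (hR : IsHeckeSymmetry K V q R) (k : ℕ) (Q : Module.End K V) :
    auxQ q (k + 1) * auxU f g q (k + 1) Q = LinearMap.trace K V Q * auxL f g q (k + 1) -
      q⁻¹ * auxQ q k * auxU f g q k (auxRop f g Q) := by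
  have hb := auxQ_ne q hq (k + 1)
  rw [auxQ_succ] at hb ⊢
  exact auxA2_trace f g _ hb (auxS f g q k).Y (auxS f g q k).A1 (auxS_inv f g q hq0 hq R hfg hR k).2.1 Q

theorem auxU_unroll {N : ℕ} (f g : Fin N → Module.End K V) (q : K) (hq0 : q ≠ 0)
    (hq : ∀ k : ℕ, q ^ (k + 1) ≠ 1)
    (R : Module.End K (V ⊗[K] V)) (hfg : R = ∑ i, TensorProduct.map (f i) (g i))
    (hR : IsHeckeSymmetry K V q R) (k : ℕ) (Q : Module.End K V) :
    auxQ q k * auxU f g q k Q = ∑ t ∈ Finset.HasAntidiagonal.antidiagonal k,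
      (-q⁻¹) ^ t.1 * LinearMap.trace K V ((auxRop f g ^ t.1) Q) * auxL f g q t.2 := by
  induction k generalizing Q with
  | zero => simp [auxU_zero, auxQ_zero, auxL_zero]
  | succ k ih =>
    rw [auxU_succ f g q hq0 hq R hfg hR, mul_assoc, ih, Finset.Nat.sum_antidiagonal_succ, Finset.mul_sum]
    rw [sub_eq_add_neg, ← Finset.sum_neg_distrib]
    congr 1
    · simp
    · refine Finset.sum_congr rfl fun t _ => ?_
      have : (auxRop f g ^ (t.1 + 1)) Q = (auxRop f g ^ t.1) (auxRop f g Q) := by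
        rw [pow_succ]; rfl
      simp only [this]
      ring

theorem aux_newton {N : ℕ} (f g : Fin N → Module.End K V) (q : K) (hq0 : q ≠ 0)
    (hq : ∀ k : ℕ, q ^ (k + 1) ≠ 1)
    (R : Module.End K (V ⊗[K] V)) (hfg : R = ∑ i, TensorProduct.map (f i) (g i))
    (hR : IsHeckeSymmetry K V q R) (k : ℕ) :
    (1 - q⁻¹ ^ (k + 1)) * auxL f g q (k + 1) = (1 - q⁻¹) * ∑ t ∈ Finset.HasAntidiagonal.antidiagonal k,
      (-q⁻¹) ^ t.1 * LinearMap.trace K V ((auxRop f g ^ t.1) 1) * auxL f g q t.2 := by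
  rw [← auxU_unroll f g q hq0 hq R hfg hR, ← auxQ_mul, auxU_one, mul_assoc]

end AuxNewton

section AuxBridge

variable {K : Type} [Field K] {V : Type} [AddCommGroup V] [Module K V]

/-- the degree one generators -/
def auxIota (R : Module.End K (V ⊗[K] V)) : V →ₗ[K] RingQuot (lambdaRel K V R) :=
  (RingQuot.mkAlgHom K (lambdaRel K V R)).toLinearMap ∘ₗ TensorAlgebra.ι K

/-- multiplication by generators -/
def auxExt (R : Module.End K (V ⊗[K] V)) (Y : Type) [AddCommGroup Y] [Module K Y]
    (ρ : Y →ₗ[K] RingQuot (lambdaRel K V R)) : V ⊗[K] Y →ₗ[K] RingQuot (lambdaRel K V R) :=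
  TensorProduct.lift ((LinearMap.mul K _).compl₁₂ (auxIota R) ρ)

theorem auxExt_tmul (R : Module.End K (V ⊗[K] V)) (Y : Type) [AddCommGroup Y] [Module K Y]
    (ρ : Y →ₗ[K] RingQuot (lambdaRel K V R)) (v : V) (y : Y) :
    auxExt R Y ρ (v ⊗ₜ y) = auxIota R v * ρ y := rfl

theorem auxExt_range (R : Module.End K (V ⊗[K] V)) (Y : Type) [AddCommGroup Y] [Module K Y]
    (ρ : Y →ₗ[K] RingQuot (lambdaRel K V R)) :
    LinearMap.range (auxExt R Y ρ) = LinearMap.range (auxIota R) * LinearMap.range ρ := by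
  apply le_antisymm
  · rintro _ ⟨t, rfl⟩
    induction t using TensorProduct.induction_on with
    | zero => rw [map_zero]; exact Submodule.zero_mem _
    | tmul v y => exact Submodule.mul_mem_mul ⟨v, rfl⟩ ⟨y, rfl⟩
    | add s t hs ht => rw [map_add]; exact Submodule.add_mem _ hs ht
  · rw [Submodule.mul_le]
    rintro _ ⟨v, rfl⟩ _ ⟨y, rfl⟩
    exact ⟨v ⊗ₜ y, rfl⟩

theorem auxExt_map (R : Module.End K (V ⊗[K] V)) (Y : Type) [AddCommGroup Y] [Module K Y]
    (ρ : Y →ₗ[K] RingQuot (lambdaRel K V R)) (B : Module.End K Y) :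
    auxExt R Y ρ ∘ₗ TensorProduct.map 1 B = auxExt R Y (ρ ∘ₗ B) := by
  ext v y
  simp [auxExt_tmul]

theorem auxIota_rel (R : Module.End K (V ⊗[K] V)) (u : V ⊗[K] V) :
    RingQuot.mkAlgHom K (lambdaRel K V R) (mulTwo K V (R u)) =
      - RingQuot.mkAlgHom K (lambdaRel K V R) (mulTwo K V u) := by
  have := RingQuot.mkAlgHom_rel K (s := lambdaRel K V R) (x := mulTwo K V ((R + (LinearMap.id : Module.End K (V ⊗[K] V))) u)) (y := 0) ⟨rfl, u, rfl⟩
  rw [LinearMap.add_apply, map_add, map_add, map_zero, LinearMap.id_apply] at this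
  exact eq_neg_of_add_eq_zero_left this

theorem auxIota_mul (R : Module.End K (V ⊗[K] V)) (v w : V) :
    auxIota R v * auxIota R w = RingQuot.mkAlgHom K (lambdaRel K V R) (mulTwo K V (v ⊗ₜ w)) := by
  simp [auxIota, mulTwo]

theorem auxExt_T {N : ℕ} (f g : Fin N → Module.End K V) (R : Module.End K (V ⊗[K] V))
    (hfg : R = ∑ i, TensorProduct.map (f i) (g i)) (Y : Type) [AddCommGroup Y] [Module K Y]
    (ρ : Y →ₗ[K] RingQuot (lambdaRel K V R)) :
    auxExt R _ (auxExt R Y ρ) ∘ₗ auxT f g Y = - auxExt R _ (auxExt R Y ρ) := by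
  apply TensorProduct.ext'
  intro v t
  induction t using TensorProduct.induction_on with
  | zero => simp
  | add s t hs ht => rw [TensorProduct.tmul_add, map_add, map_add, hs, ht]
  | tmul w y =>
    have e : R (v ⊗ₜ w) = ∑ i, f i v ⊗ₜ[K] g i w := by
      conv_lhs => rw [hfg]
      simp [LinearMap.sum_apply]
    have := congrArg (· * ρ y) (auxIota_rel R (v ⊗ₜ w))
    simp only [e, map_sum, ← auxIota_mul, Finset.sum_mul] at this
    simp only [LinearMap.comp_apply, auxT, LinearMap.sum_apply, map_sum, TensorProduct.map_tmul, auxExt_tmul,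
      Module.End.one_apply, LinearMap.neg_apply, ← mul_assoc]
    exact this.trans (neg_mul (α := RingQuot (lambdaRel K V R)) (auxIota R v * auxIota R w) (ρ y))

theorem aux_scal {W M : Type} [AddCommGroup W] [Module K W] [AddCommGroup M] [Module K M] (Z : W →ₗ[K] M) (s : K)
    (hs : 1 + s ≠ 0) : (1 + s)⁻¹ • (Z - s • (-Z)) = Z := by
  rw [show Z - s • (-Z) = (1 + s) • Z by module, smul_smul, inv_mul_cancel₀ hs, one_smul]

variable [FiniteDimensional K V]

/-- projection onto graded pieces -/
def auxRho {N : ℕ} (f g : Fin N → Module.End K V) (q : K) (R : Module.End K (V ⊗[K] V)) :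
    (k : ℕ) → (auxS f g q k).Y →ₗ[K] RingQuot (lambdaRel K V R)
  | 0 => Algebra.linearMap K (RingQuot (lambdaRel K V R))
  | k + 1 => auxExt R (auxS f g q k).Y (auxRho f g q R k)

theorem auxRho_range {N : ℕ} (f g : Fin N → Module.End K V) (q : K) (R : Module.End K (V ⊗[K] V)) (k : ℕ) :
    LinearMap.range (auxRho f g q R k) = lambdaGrade K V R k := by
  induction k with
  | zero =>
    unfold lambdaGrade
    rw [pow_zero, Submodule.map_one, Submodule.one_eq_range]
    rfl
  | succ k ih =>
    have := auxExt_range R (auxS f g q k).Y (auxRho f g q R k)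
    refine this.trans ?_
    rw [ih]
    unfold lambdaGrade auxIota
    rw [pow_succ', Submodule.map_mul, LinearMap.range_comp]

theorem auxRho_A {N : ℕ} (f g : Fin N → Module.End K V) (q : K) (hq : ∀ k : ℕ, q ^ (k + 1) ≠ 1) 
    (R : Module.End K (V ⊗[K] V))
    (hfg : R = ∑ i, TensorProduct.map (f i) (g i)) (k : ℕ) :
    auxRho f g q R k ∘ₗ (auxS f g q k).A = auxRho f g q R k ∧
    auxExt R _ (auxRho f g q R k) ∘ₗ (auxS f g q k).A1 = auxExt R _ (auxRho f g q R k) := by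
  induction k with
  | zero => exact ⟨rfl, rfl⟩
  | succ k ih =>
    refine ⟨ih.2, ?_⟩
    have key : ∀ (Y : Type) [AddCommGroup Y] [Module K Y] (ρ : Y →ₗ[K] RingQuot (lambdaRel K V R))
        (B : Module.End K (V ⊗[K] Y)) (s : K) (hs : 1 + s ≠ 0), auxExt R _ ρ ∘ₗ B = auxExt R _ ρ →
        auxExt R _ (auxExt R _ ρ) ∘ₗ auxA2 f g s Y B = auxExt R _ (auxExt R _ ρ) := by
      intro Y _ _ ρ B s hs h
      have h1 : auxExt R _ (auxExt R _ ρ) ∘ₗ TensorProduct.map 1 B = auxExt R _ (auxExt R _ ρ) := by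
        rw [auxExt_map, h]
      have h2 := auxExt_T f g R hfg Y ρ
      unfold auxA2
      rw [LinearMap.comp_smul, LinearMap.comp_sub, LinearMap.comp_smul, Module.End.mul_eq_comp,
        Module.End.mul_eq_comp, ← LinearMap.comp_assoc, ← LinearMap.comp_assoc, h1, h2, LinearMap.neg_comp, h1]
      exact aux_scal _ _ hs
    have hb := auxQ_ne q hq (k + 1)
    rw [auxQ_succ] at hb
    exact key (auxS f g q k).Y (auxRho f g q R k) (auxS f g q k).A1 _ hb ih.2

/-- components of the left regular representation -/
def auxLc {N : ℕ} (f g : Fin N → Module.End K V) (q : K) :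
    (k : ℕ) → V →ₗ[K] ((j : ℕ) → (auxS f g q j).Y) →ₗ[K] (auxS f g q k).Y
  | 0 => 0
  | k + 1 => ((TensorProduct.mk K V (auxS f g q k).Y).compr₂ (auxS f g q k).A1).compl₂ (LinearMap.proj k)

/-- left regular representation -/
def auxLr {N : ℕ} (f g : Fin N → Module.End K V) (q : K) :
    V →ₗ[K] Module.End K ((j : ℕ) → (auxS f g q j).Y) where
  toFun v := LinearMap.pi fun k => auxLc f g q k v
  map_add' v w := by
    ext x k
    simp
  map_smul' c v := by
    ext x k
    simp

theorem auxLr_zero {N : ℕ} (f g : Fin N → Module.End K V) (q : K) (v : V) (x : (j : ℕ) → (auxS f g q j).Y) :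
    auxLr f g q v x 0 = 0 := rfl

theorem auxLr_succ {N : ℕ} (f g : Fin N → Module.End K V) (q : K) (v : V) (x : (j : ℕ) → (auxS f g q j).Y) (k : ℕ) :
    auxLr f g q v x (k + 1) = (auxS f g q k).A1 (v ⊗ₜ x k) := rfl

theorem auxLr_rel {N : ℕ} (f g : Fin N → Module.End K V) (q : K) (hq0 : q ≠ 0)
    (hq : ∀ k : ℕ, q ^ (k + 1) ≠ 1)
    (R : Module.End K (V ⊗[K] V)) (hfg : R = ∑ i, TensorProduct.map (f i) (g i))
    (hR : IsHeckeSymmetry K V q R) (u : V ⊗[K] V) :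
    TensorAlgebra.lift K (auxLr f g q) (mulTwo K V ((R + (LinearMap.id : Module.End K (V ⊗[K] V))) u)) = 0 := by
  have key : ∀ (u : V ⊗[K] V) (x : (j : ℕ) → (auxS f g q j).Y) (k : ℕ)
      (A2 : Module.End K (V ⊗[K] (V ⊗[K] (auxS f g q k).Y))) (hA2 : A2 = (auxS f g q (k + 1)).A1),
      TensorAlgebra.lift K (auxLr f g q) (mulTwo K V u) x (k + 2) =
        A2 (TensorProduct.assoc K V V (auxS f g q k).Y (u ⊗ₜ x k)) := by
    intro u x k A2 hA2
    have hA := (auxS_facts f g q hq0 hq R hfg hR k A2 hA2).1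
    induction u using TensorProduct.induction_on with
    | zero => simp; rfl
    | add s t hs ht => 
      rw [map_add, map_add, LinearMap.add_apply, Pi.add_apply, hs, ht, TensorProduct.add_tmul, map_add, map_add]
      rfl
    | tmul v w =>
      simp only [mulTwo, TensorProduct.lift.tmul, LinearMap.compl₁₂_apply, LinearMap.mul_apply', map_mul,
        TensorAlgebra.lift_ι_apply, Module.End.mul_apply, TensorProduct.assoc_tmul]
      rw [← hA, auxLr_succ, auxLr_succ, hA2]
      rfl
  have key0 : ∀ (u : V ⊗[K] V) (x : (j : ℕ) → (auxS f g q j).Y),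
      TensorAlgebra.lift K (auxLr f g q) (mulTwo K V u) x 0 = 0 ∧
      TensorAlgebra.lift K (auxLr f g q) (mulTwo K V u) x 1 = 0 := by
    intro u x
    induction u using TensorProduct.induction_on with
    | zero => simp
    | add s t hs ht => 
      rw [map_add, map_add, LinearMap.add_apply, Pi.add_apply, Pi.add_apply, hs.1, hs.2, ht.1, ht.2]
      simp
    | tmul v w =>
      simp only [mulTwo, TensorProduct.lift.tmul, LinearMap.compl₁₂_apply, LinearMap.mul_apply', map_mul,
        TensorAlgebra.lift_ι_apply, Module.End.mul_apply]
      refine ⟨rfl, ?_⟩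
      rw [auxLr_succ, auxLr_zero, TensorProduct.tmul_zero, map_zero]
      rfl
  apply LinearMap.ext
  intro x
  funext k
  match k with
  | 0 => exact (key0 _ x).1
  | 1 => exact (key0 _ x).2
  | k + 2 =>
    obtain ⟨A2, hA2⟩ : ∃ A2 : Module.End K (V ⊗[K] (V ⊗[K] (auxS f g q k).Y)), A2 = (auxS f g q (k + 1)).A1 := ⟨_, rfl⟩
    rw [key _ x k A2 hA2]
    have hT := (auxS_facts f g q hq0 hq R hfg hR k A2 hA2).2.1
    have e : TensorProduct.assoc K V V (auxS f g q k).Y (((R + (LinearMap.id : Module.End K (V ⊗[K] V))) u) ⊗ₜ x k) =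
        auxT f g (auxS f g q k).Y (TensorProduct.assoc K V V (auxS f g q k).Y (u ⊗ₜ x k)) +
        TensorProduct.assoc K V V (auxS f g q k).Y (u ⊗ₜ x k) := by
      rw [auxT_conj, ← hfg, LinearEquiv.conj_apply]
      simp [TensorProduct.add_tmul]
    have hT' := LinearMap.congr_fun hT (TensorProduct.assoc K V V (auxS f g q k).Y (u ⊗ₜ x k))
    rw [e, map_add]
    rw [Module.End.mul_apply] at hT'
    rw [hT']
    exact neg_add_cancel _

/-- the representation of the exterior algebra -/
def auxTheta {N : ℕ} (f g : Fin N → Module.End K V) (q : K) (hq0 : q ≠ 0)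
    (hq : ∀ k : ℕ, q ^ (k + 1) ≠ 1)
    (R : Module.End K (V ⊗[K] V)) (hfg : R = ∑ i, TensorProduct.map (f i) (g i))
    (hR : IsHeckeSymmetry K V q R) :
    RingQuot (lambdaRel K V R) →ₐ[K] Module.End K ((j : ℕ) → (auxS f g q j).Y) :=
  RingQuot.liftAlgHom K ⟨TensorAlgebra.lift K (auxLr f g q), by
    rintro a b ⟨rfl, u, rfl⟩
    rw [auxLr_rel f g q hq0 hq R hfg hR, map_zero]⟩

theorem auxTheta_iota {N : ℕ} (f g : Fin N → Module.End K V) (q : K) (hq0 : q ≠ 0)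
    (hq : ∀ k : ℕ, q ^ (k + 1) ≠ 1)
    (R : Module.End K (V ⊗[K] V)) (hfg : R = ∑ i, TensorProduct.map (f i) (g i))
    (hR : IsHeckeSymmetry K V q R) (v : V) :
    auxTheta f g q hq0 hq R hfg hR (auxIota R v) = auxLr f g q v := by
  simp [auxTheta, auxIota]

/-- vacuum vector -/
def auxVac {N : ℕ} (f g : Fin N → Module.End K V) (q : K) : (j : ℕ) → (auxS f g q j).Y
  | 0 => (1 : K)
  | _ + 1 => 0

theorem auxTheta_rho {N : ℕ} (f g : Fin N → Module.End K V) (q : K) (hq0 : q ≠ 0)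
    (hq : ∀ k : ℕ, q ^ (k + 1) ≠ 1)
    (R : Module.End K (V ⊗[K] V)) (hfg : R = ∑ i, TensorProduct.map (f i) (g i))
    (hR : IsHeckeSymmetry K V q R) (k : ℕ) (z : (auxS f g q k).Y) :
    auxTheta f g q hq0 hq R hfg hR (auxRho f g q R k z) (auxVac f g q) k = (auxS f g q k).A z := by
  induction k with
  | zero =>
    change K at z
    have h : auxTheta f g q hq0 hq R hfg hR (auxRho f g q R 0 z) = algebraMap K _ z := AlgHom.commutes _ _
    rw [h, Module.algebraMap_end_apply]
    exact mul_one (M := K) z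
  | succ k ih =>
    have hA : (auxS f g q k).A1 * TensorProduct.map 1 (auxS f g q k).A = (auxS f g q k).A1 := by
      cases k with
      | zero => 
        have : TensorProduct.map (1 : Module.End K V) (auxS f g q 0).A = 1 := TensorProduct.map_one
        rw [this, mul_one]
      | succ k => exact (auxS_facts f g q hq0 hq R hfg hR k _ rfl).1
    change V ⊗[K] (auxS f g q k).Y at z
    change _ = (auxS f g q k).A1 z
    induction z using TensorProduct.induction_on with
    | zero =>
      rw [LinearMap.map_zero]
      have e : auxRho f g q R (k + 1) (0 : V ⊗[K] (auxS f g q k).Y) = 0 := LinearMap.map_zero (auxRho f g q R (k + 1))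
      rw [e, map_zero]
      rfl
    | add s t hs ht =>
      rw [map_add, ← hs, ← ht]
      have e : auxRho f g q R (k + 1) (s + t) = auxRho f g q R (k + 1) s + auxRho f g q R (k + 1) t := map_add _ _ _
      rw [e, map_add]
      rfl
    | tmul v y =>
      have e : auxRho f g q R (k + 1) (v ⊗ₜ[K] y) = auxIota R v * auxRho f g q R k y := rfl
      rw [e, map_mul, Module.End.mul_apply, auxTheta_iota, auxLr_succ, ih, ← LinearMap.congr_fun hA (v ⊗ₜ[K] y)]
      rfl

theorem aux_finrank {N : ℕ} (f g : Fin N → Module.End K V) (q : K) (hq0 : q ≠ 0)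
    (hq : ∀ k : ℕ, q ^ (k + 1) ≠ 1)
    (R : Module.End K (V ⊗[K] V)) (hfg : R = ∑ i, TensorProduct.map (f i) (g i))
    (hR : IsHeckeSymmetry K V q R) (k : ℕ) :
    (Module.finrank K (lambdaGrade K V R k) : K) = auxL f g q k := by
  have hker : LinearMap.ker (auxRho f g q R k) = LinearMap.ker (auxS f g q k).A := by
    apply le_antisymm
    · intro z hz
      rw [LinearMap.mem_ker] at hz ⊢
      rw [← auxTheta_rho f g q hq0 hq R hfg hR k z, hz, map_zero]
      rfl
    · intro z hz
      rw [LinearMap.mem_ker] at hz ⊢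
      rw [← (auxRho_A f g q hq R hfg k).1, LinearMap.comp_apply, hz, map_zero]
  have h1 := LinearMap.finrank_range_add_finrank_ker (auxRho f g q R k)
  have h2 := LinearMap.finrank_range_add_finrank_ker (auxS f g q k).A
  rw [hker, auxRho_range] at h1
  have h3 : Module.finrank K (lambdaGrade K V R k) = Module.finrank K (LinearMap.range (auxS f g q k).A) := by
    omega
  rw [h3]
  exact (LinearMap.IsProj.trace (LinearMap.IsIdempotentElem.isProj_range _ 
    (auxS_inv f g q hq0 hq R hfg hR k).1)).symm

end AuxBridge

/-- The dimension identity `a_m · dim Λ_k = ∑_{i=0}^{k} a_{m-k+i} · h_i(y₁⁻¹, …, yₙ⁻¹)`,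
with the convention `a_j = 0` for `j < 0`. -/
theorem poincare_series_lambda_dim_formula
    (K : Type) [Field K] [CharZero K]
    (V : Type) [AddCommGroup V] [Module K V] [FiniteDimensional K V]
    (q : K) (hq0 : q ≠ 0) (hq : ∀ n : ℕ, 1 < n → q ^ n ≠ 1)
    (R : V ⊗[K] V →ₗ[K] V ⊗[K] V) (hR : IsHeckeSymmetry K V q R)
    (m n : ℕ) (x : Fin m → ℝ) (y : Fin n → ℝ)
    (hx : ∀ i, 0 < x i) (hy : ∀ j, 0 < y j)
    (P : Polynomial ℝ)
    (hP : P = ∏ i : Fin m, (1 + Polynomial.C (x i) * Polynomial.X))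
    (heq : poincareLambda K V R *
        ((∏ j : Fin n, (1 - Polynomial.C (y j) * Polynomial.X) : Polynomial ℝ) :
          PowerSeries ℝ) = (P : PowerSeries ℝ))
    (a : ℤ → ℝ) (ha : ∀ j : ℤ, a j = if 0 ≤ j then P.coeff j.toNat else 0) :
    ∀ l : ℕ,
      P.coeff m * (Module.finrank K (lambdaGrade K V R l) : ℝ) =
        ∑ i ∈ Finset.range (l + 1),
          a ((m : ℤ) - (l : ℤ) + (i : ℤ)) * completeHomog n i (fun j => (y j)⁻¹) := by
  have hq' : ∀ k : ℕ, q ^ (k + 1) ≠ 1 := by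
    intro k h
    cases k with
    | zero =>
      apply hq 2 (by norm_num)
      rw [zero_add, pow_one] at h
      rw [h, one_pow]
    | succ k => exact hq (k + 1 + 1) (by omega) h
  obtain ⟨N, f, g, hfg⟩ := aux_decomp R
  obtain ⟨p, d, c, hc, hrec, hN, hp⟩ := aux_trace_part q hq0 R hR f g hfg
  have hfin := aux_finrank f g q hq0 hq' R hfg hR
  have hyy : ∀ z : Fin n → ℝ, ((∏ j : Fin n, (1 - Polynomial.C (z j) * Polynomial.X) : Polynomial ℝ) :
          PowerSeries ℝ) = auxE (fun j => - z j) := by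
    intro z
    rw [← auxE_coe]
    simp [sub_eq_add_neg]
  have h0 : Module.finrank K (lambdaGrade K V R 0) = 1 := by
    have := hfin 0
    rw [auxL_zero] at this
    exact_mod_cast this
  have key := aux_combine q hq0 hq' p d c hc hrec hN (fun l => Module.finrank K (lambdaGrade K V R l)) h0
    (by
      intro k
      have := aux_newton f g q hq0 hq' R hfg hR k
      simp only [hfin, hp]
      exact this) x y hx hy
    (by rw [← hyy, ← auxE_coe, ← hP]; exact heq)
  intro l
  have fin := aux_final x y hx P hP a ha (poincareLambda K V R)
    (by rw [hyy, auxE_coe]; exact key) l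
  rw [← fin]
  simp [poincareLambda]

end
end

section
/- Let m, n be natural numbers and x_1, …, x_m, y_1, …, y_n positive real numbers. Write P(t) = ∏_{i=1}^m (1 + x_i t) = ∑_{i=0}^m a_i t^i and Q(t) = ∏_{j=1}^n (1 − y_j t) = ∑_{j=0}^n (−1)^j b_j t^j, and set P̃(t) = ∑_{i=0}^m a_{m−i} t^i and Q̃(t) = ∑_{j=0}^n (−1)^j b_{n−j} t^j. If the polynomial identity b_n · P̃(t) · Q(t) = a_m · Q̃(t) · P(t) holds, then a_i = a_{m−i} for all 0 ≤ i ≤ m and b_j = b_{n−j} for all 0 ≤ j ≤ n. -/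
open Polynomial

/-- If `P = ∏ (1 + xᵢ t)` and `Q = ∏ (1 - yⱼ t)` with `xᵢ, yⱼ > 0` satisfy
`bₙ · P̃ · Q = a_m · Q̃ · P`, where `P̃, Q̃` are the coefficient-reversed
polynomials, then `P` is reciprocal and `Q` is skew-reciprocal. -/
theorem reciprocal_of_functional_equation
    (m n : ℕ) (x : Fin m → ℝ) (y : Fin n → ℝ)
    (hx : ∀ i, 0 < x i) (hy : ∀ j, 0 < y j)
    (P Q Pt Qt : Polynomial ℝ)
    (hP : P = ∏ i : Fin m, (1 + Polynomial.C (x i) * Polynomial.X))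
    (hQ : Q = ∏ j : Fin n, (1 - Polynomial.C (y j) * Polynomial.X))
    (hPt : Pt = ∑ i ∈ Finset.range (m + 1), Polynomial.C (P.coeff (m - i)) * Polynomial.X ^ i)
    (hQt : Qt = ∑ j ∈ Finset.range (n + 1),
        Polynomial.C ((-1 : ℝ) ^ j * ((-1 : ℝ) ^ (n - j) * Q.coeff (n - j))) * Polynomial.X ^ j)
    (hid : Polynomial.C ((-1 : ℝ) ^ n * Q.coeff n) * (Pt * Q) =
        Polynomial.C (P.coeff m) * (Qt * P)) :
    (∀ i ≤ m, P.coeff i = P.coeff (m - i)) ∧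
    (∀ j ≤ n, (-1 : ℝ) ^ j * Q.coeff j = (-1 : ℝ) ^ (n - j) * Q.coeff (n - j)) := by
  have hP0 : P.coeff 0 = 1 := by
    rw [hP, Polynomial.coeff_zero_prod]; simp
  have hQ0 : Q.coeff 0 = 1 := by
    rw [hQ, Polynomial.coeff_zero_prod]; simp
  have hdP : ∀ i, (1 + C (x i) * X : ℝ[X]).natDegree ≤ 1 := fun i => by compute_degree
  have hdQ : ∀ i, (1 - C (y i) * X : ℝ[X]).natDegree ≤ 1 := fun i => by compute_degree
  have hPm : P.coeff m = ∏ i, x i := by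
    have := Polynomial.coeff_prod_of_natDegree_le (s := Finset.univ)
      (fun i => (1 + C (x i) * X : ℝ[X])) 1 (fun i _ => hdP i)
    simpa [← hP, Polynomial.coeff_one] using this
  have hQn : Q.coeff n = ∏ i, (-y i) := by
    have := Polynomial.coeff_prod_of_natDegree_le (s := Finset.univ)
      (fun i => (1 - C (y i) * X : ℝ[X])) 1 (fun i _ => hdQ i)
    rw [← hQ] at this
    simpa [Polynomial.coeff_one] using this
  have ha : 0 < P.coeff m := by
    rw [hPm]; exact Finset.prod_pos fun i _ => hx i
  have hb : 0 < (-1 : ℝ) ^ n * Q.coeff n := by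
    have : (-1 : ℝ) ^ n * Q.coeff n = ∏ i, y i := by
      rw [hQn, Finset.prod_neg]
      simp [← mul_assoc, ← mul_pow]
    rw [this]; exact Finset.prod_pos fun i _ => hy i
  have hPdeg : P.natDegree ≤ m := by
    rw [hP]
    refine (Polynomial.natDegree_prod_le _ _).trans ?_
    refine (Finset.sum_le_sum fun i _ => hdP i).trans ?_
    simp
  have hPd : P.natDegree = m := le_antisymm hPdeg (Polynomial.le_natDegree_of_ne_zero ha.ne')
  have hPne : P ≠ 0 := by
    rintro h; rw [h] at ha; simp at ha
  have hcop : IsCoprime P Q := by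
    rw [hP, hQ]
    refine IsCoprime.prod_left fun i _ => IsCoprime.prod_right fun j _ => ?_
    have hxy : x i + y j ≠ 0 := (add_pos (hx i) (hy j)).ne'
    refine ⟨C (y j / (x i + y j)), C (x i / (x i + y j)), ?_⟩
    have h1 : y j / (x i + y j) + x i / (x i + y j) = 1 := by field_simp; ring
    have h2 : y j / (x i + y j) * x i - x i / (x i + y j) * y j = 0 := by ring
    calc _ = C (y j / (x i + y j) + x i / (x i + y j))
          + C (y j / (x i + y j) * x i - x i / (x i + y j) * y j) * X := by
            simp only [C_add, C_sub, C_mul]; ring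
      _ = 1 := by rw [h1, h2]; simp
  have hPtc : ∀ i ≤ m, Pt.coeff i = P.coeff (m - i) := by
    intro i hi
    rw [hPt, Polynomial.finset_sum_coeff]
    simp only [Polynomial.coeff_C_mul_X_pow]
    rw [Finset.sum_ite_eq, if_pos (by simp; omega)]
  have hQtc : ∀ j ≤ n, Qt.coeff j = (-1 : ℝ) ^ j * ((-1 : ℝ) ^ (n - j) * Q.coeff (n - j)) := by
    intro i hi
    rw [hQt, Polynomial.finset_sum_coeff]
    simp only [Polynomial.coeff_C_mul_X_pow]
    rw [Finset.sum_ite_eq, if_pos (by simp; omega)]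
  have hPtd : Pt.natDegree ≤ m := by
    rw [hPt]
    refine Polynomial.natDegree_sum_le_of_forall_le _ _ fun i hi => ?_
    refine (Polynomial.natDegree_C_mul_X_pow_le _ _).trans ?_
    have := Finset.mem_range.1 hi
    omega
  have hdvd : P ∣ Pt := by
    have h1 : P ∣ C ((-1 : ℝ) ^ n * Q.coeff n) * (Pt * Q) := by
      rw [hid]; exact Dvd.intro_left (C (P.coeff m) * Qt) (by ring)
    have hu : IsUnit (C ((-1 : ℝ) ^ n * Q.coeff n)) := Polynomial.isUnit_C.2 hb.ne'.isUnit
    exact hcop.dvd_of_dvd_mul_right (hu.dvd_mul_left.1 h1)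
  obtain ⟨R, hR⟩ := hdvd
  have hRne : R ≠ 0 := by
    rintro rfl
    have h := hPtc 0 (Nat.zero_le _)
    rw [hR] at h
    simp at h
    exact ha.ne h
  have hRd : R.natDegree = 0 := by
    have h := Polynomial.natDegree_mul hPne hRne
    rw [← hR] at h
    omega
  obtain ⟨c, rfl⟩ := Polynomial.natDegree_eq_zero.1 hRd
  have hc : ∀ i ≤ m, P.coeff (m - i) = P.coeff i * c := by
    intro i hi
    rw [← hPtc i hi, hR, Polynomial.coeff_mul_C]
  have e0 := hc 0 (Nat.zero_le _)
  have em := hc m le_rfl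
  rw [Nat.sub_zero, hP0, one_mul] at e0
  rw [Nat.sub_self, hP0, ← e0] at em
  have ha1 : P.coeff m = 1 := by nlinarith
  rw [ha1] at e0
  subst e0
  have hQQ : C ((-1 : ℝ) ^ n * Q.coeff n) * Q = Qt := by
    apply mul_right_cancel₀ hPne
    rw [ha1, hR] at hid
    simp only [C_1, one_mul, mul_one] at hid
    rw [← hid]; ring
  have hq : ∀ j ≤ n, ((-1 : ℝ) ^ n * Q.coeff n) * Q.coeff j
      = (-1 : ℝ) ^ j * ((-1 : ℝ) ^ (n - j) * Q.coeff (n - j)) := by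
    intro j hj
    rw [← hQtc j hj, ← hQQ, Polynomial.coeff_C_mul]
  have hsq : ∀ k : ℕ, (-1 : ℝ) ^ k * (-1 : ℝ) ^ k = 1 := fun k => by
    rw [← mul_pow]; simp
  have hb1 : (-1 : ℝ) ^ n * Q.coeff n = 1 := by
    have h := hq n le_rfl
    rw [Nat.sub_self, hQ0] at h
    have h3 : ((-1 : ℝ) ^ n * Q.coeff n) * ((-1 : ℝ) ^ n * Q.coeff n) = 1 := by
      calc _ = (-1 : ℝ) ^ n * (((-1 : ℝ) ^ n * Q.coeff n) * Q.coeff n) := by ring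
        _ = 1 := by rw [h]; simp [hsq]
    nlinarith
  refine ⟨fun i hi => by rw [hc i hi, mul_one], fun j hj => ?_⟩
  have h := hq j hj
  rw [hb1, one_mul] at h
  rw [h, ← mul_assoc, hsq, one_mul]
end
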